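/- There are constants c, c', c'' > 0 depending only on d ≥ 3 such that: for all integers L ≥ 1 and K ≥ c, every A ⊆ B(0,L), every finite connected U ⊇ B(0,KL) and every z ∈ ∂U, setting h(x) = P_x[X_{T_U} = z] and D = B(0,2L), for every x ∈ ∂D one has P_x[T_U < H_A] ≥ P_x[H_{B(0,L)} = ∞] ≥ c' > 0, and there is a real γ(x) with |γ(x)| ≤ c''/K such that P_x[T_U < H_A, X_{T_U} = z] = h(0)·P_x[T_U < H_A]·(1 + γ(x)). -/

import Mathlib

open MeasureTheory ENNReal Set
open scoped Classical NNReal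

namespace Disconnection

/-- Points of `ℤ^d`. -/
abbrev Zd (d : ℕ) := Fin d → ℤ

/-- Step distribution of the simple random walk: uniform weight `1/(2d)` on each of the
`2d` unit vectors of `ℤ^d`. -/
noncomputable def stepP (d : ℕ) (v : Zd d) : ℝ≥0∞ :=
  if (∑ i, (v i).natAbs) = 1 then ((2 * d : ℕ) : ℝ≥0∞)⁻¹ else 0

/-- The exponential distribution of rate `1` on `[0,∞)` (as a measure on `ℝ`). -/
noncomputable def expMeasure : Measure ℝ :=
  MeasureTheory.volume.withDensity fun t => ENNReal.ofReal (if 0 < t then Real.exp (-t) else 0)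

/-- Nearest neighbours in `ℤ^d` (Euclidean distance one). -/
def adjacent {d : ℕ} (x y : Zd d) : Prop := (∑ i, (x i - y i).natAbs) = 1

/-- (Outer) boundary `∂A` of a set `A ⊆ ℤ^d`. -/
def bdry {d : ℕ} (A : Set (Zd d)) : Set (Zd d) := {y | y ∉ A ∧ ∃ x ∈ A, adjacent x y}

/-- sup-norm distance between two points of `ℤ^d`. -/
def supDist {d : ℕ} (x y : Zd d) : ℕ := Finset.univ.sup fun i => (x i - y i).natAbs

/-- closed sup-norm ball `B(x,r)` in `ℤ^d`. -/
def ball {d : ℕ} (x : Zd d) (r : ℕ) : Set (Zd d) := {y | supDist x y ≤ r}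

/-- mutual sup-norm distance between two sets. -/
noncomputable def setDist {d : ℕ} (A B : Set (Zd d)) : ℕ := sInf {n | ∃ x ∈ A, ∃ y ∈ B, supDist x y = n}

/-- the box `ℤ^d ∩ [a,b)^d`. -/
def intBox {d : ℕ} (a b : ℤ) : Set (Zd d) := {y | ∀ i, a ≤ y i ∧ y i < b}

/-- A box in `ℤ^d`: a translate of `[0,L)^d ∩ ℤ^d` with `L ≥ 1`. -/
def isBox {d : ℕ} (S : Set (Zd d)) : Prop :=
  ∃ L : ℕ, 1 ≤ L ∧ ∃ a : Zd d, S = {y | ∀ i, a i ≤ y i ∧ y i < a i + L}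

/-- connectedness of a subset of `ℤ^d` by nearest-neighbour paths. -/
def connSet {d : ℕ} (S : Set (Zd d)) : Prop :=
  ∀ a ∈ S, ∀ b ∈ S, ∃ (n : ℕ) (f : ℕ → Zd d), f 0 = a ∧ f n = b ∧
    (∀ k ≤ n, f k ∈ S) ∧ ∀ k < n, adjacent (f k) (f (k + 1))

/-- Euclidean norm of a lattice point. -/
noncomputable def eucNorm {d : ℕ} (x : Zd d) : ℝ := Real.sqrt (∑ i, ((x i : ℝ)) ^ 2)

/-- A model of the continuous-time simple random walk on `ℤ^d` with unit jump rate: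
`Y` is the discrete jump chain and `ζ` are the holding times; under `P x` one has
`Y 0 = x` a.s., and the increments of `Y` together with the holding times are mutually
independent, the increments uniform on the `2d` unit vectors and the holding times
exponential of rate `1`.  This is expressed through the finite-dimensional cylinder
probabilities, which determine the joint law. -/
structure SRW (d : ℕ) (Ω : Type*) [MeasurableSpace Ω] where
  P : Zd d → Measure Ω
  isProb : ∀ x, IsProbabilityMeasure (P x)
  Y : ℕ → Ω → Zd d
  ζ : ℕ → Ω → ℝ
  measurable_Y : ∀ n, Measurable (Y n)
  measurable_ζ : ∀ n, Measurable (ζ n)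
  Y_zero : ∀ x : Zd d, P x {ω | Y 0 ω = x} = 1
  law : ∀ (x : Zd d) (n : ℕ) (s : Fin n → Zd d) (I : Fin n → Set ℝ),
    (∀ i, MeasurableSet (I i)) →
    P x {ω | (∀ i : Fin n, Y ((i : ℕ) + 1) ω - Y (i : ℕ) ω = s i) ∧
             (∀ i : Fin n, ζ (i : ℕ) ω ∈ I i)}
      = (∏ i, stepP d (s i)) * ∏ i, expMeasure (I i)

namespace SRW

variable {d : ℕ} {Ω : Type*} [MeasurableSpace Ω]

/-- time of the `n`-th jump. -/
noncomputable def S (W : SRW d Ω) (n : ℕ) (ω : Ω) : ℝ := ∑ i ∈ Finset.range n, W.ζ i ω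

/-- index of the current step of the jump chain at time `t`. -/
noncomputable def jumpIdx (W : SRW d Ω) (t : ℝ) (ω : Ω) : ℕ := sSup {k : ℕ | W.S k ω ≤ t}

/-- the continuous-time walk `X_t`. -/
noncomputable def X (W : SRW d Ω) (t : ℝ) (ω : Ω) : Zd d := W.Y (W.jumpIdx t ω) ω

/-- entrance time of `A` after time `t` (`∞` if there is none). -/
noncomputable def hitFrom (W : SRW d Ω) (A : Set (Zd d)) (t : ℝ≥0∞) (ω : Ω) : ℝ≥0∞ :=
  sInf {u : ℝ≥0∞ | ∃ s : ℝ≥0, u = (s : ℝ≥0∞) ∧ t ≤ u ∧ W.X (s : ℝ) ω ∈ A}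

/-- entrance time `H_A = inf {t ≥ 0 : X_t ∈ A}`. -/
noncomputable def hit (W : SRW d Ω) (A : Set (Zd d)) (ω : Ω) : ℝ≥0∞ := W.hitFrom A 0 ω

/-- exit time `T_U = inf {t ≥ 0 : X_t ∉ U}`. -/
noncomputable def exit (W : SRW d Ω) (U : Set (Zd d)) (ω : Ω) : ℝ≥0∞ := W.hit Uᶜ ω

/-- hitting time `H̃_A = inf {t ≥ ζ₀ : X_t ∈ A}`. -/
noncomputable def hitTilde (W : SRW d Ω) (A : Set (Zd d)) (ω : Ω) : ℝ≥0∞ :=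
  W.hitFrom A (ENNReal.ofReal (W.ζ 0 ω)) ω

/-- the walk evaluated at a random (possibly infinite) time. -/
noncomputable def Xat (W : SRW d Ω) (τ : Ω → ℝ≥0∞) (ω : Ω) : Zd d := W.X (τ ω).toReal ω

/-- equilibrium measure `e_A(x) = P_x[H̃_A = ∞] 1_A(x)`. -/
noncomputable def eqm (W : SRW d Ω) (A : Set (Zd d)) (x : Zd d) : ℝ :=
  if x ∈ A then (W.P x {ω | W.hitTilde A ω = ⊤}).toReal else 0

/-- capacity `cap(A) = Σ_x e_A(x)`. -/
noncomputable def cap (W : SRW d Ω) (A : Set (Zd d)) : ℝ := ∑ᶠ x, W.eqm A x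

/-- normalized equilibrium measure `ē_A = e_A / cap(A)`. -/
noncomputable def ebar (W : SRW d Ω) (A : Set (Zd d)) (x : Zd d) : ℝ := W.eqm A x / W.cap A

/-- equilibrium measure of `A` relative to `U`: `e_{A,U}(x) = P_x[H̃_A > T_U] 1_A(x)`. -/
noncomputable def eqmRel (W : SRW d Ω) (A U : Set (Zd d)) (x : Zd d) : ℝ :=
  if x ∈ A then (W.P x {ω | W.exit U ω < W.hitTilde A ω}).toReal else 0

/-- `P_ρ = Σ_x ρ(x) P_x`, the walk started from the initial (sub-)measure with density `ρ`. -/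
noncomputable def Pinit (W : SRW d Ω) (ρ : Zd d → ℝ) : Measure Ω :=
  Measure.sum fun x : Zd d => ENNReal.ofReal (ρ x) • W.P x

/-- Green function `g(x,y) = E_x[∫₀^∞ 1{X_s = y} ds]`. -/
noncomputable def green (W : SRW d Ω) (x y : Zd d) : ℝ :=
  ∫ ω, (∫ s in Set.Ioi (0 : ℝ), if W.X s ω = y then (1 : ℝ) else 0) ∂ W.P x

/-- killed Green function `g_U(x,y) = E_x[∫₀^{T_U} 1{X_s = y} ds]`. -/
noncomputable def greenK (W : SRW d Ω) (U : Set (Zd d)) (x y : Zd d) : ℝ :=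
  ∫ ω, (∫ s in Set.Ioi (0 : ℝ),
      if ENNReal.ofReal s < W.exit U ω ∧ W.X s ω = y then (1 : ℝ) else 0) ∂ W.P x

/-- the potential operator `Gf(x) = Σ_y g(x,y) f(y)`. -/
noncomputable def Gop (W : SRW d Ω) (f : Zd d → ℝ) (x : Zd d) : ℝ :=
  ∑ᶠ y, W.green x y * f y

/-- successive return times to `A` (between excursions out of `U`): `Rt A U 0 = R₁ = H_A`. -/
noncomputable def Rt (W : SRW d Ω) (A U : Set (Zd d)) : ℕ → Ω → ℝ≥0∞
  | 0 => W.hit A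
  | k + 1 => fun ω => W.hitFrom A (W.hitFrom Uᶜ (W.Rt A U k ω) ω) ω

/-- successive departure times from `U`: `Dt A U k = D_{k+1}`. -/
noncomputable def Dt (W : SRW d Ω) (A U : Set (Zd d)) (k : ℕ) (ω : Ω) : ℝ≥0∞ :=
  W.hitFrom Uᶜ (W.Rt A U k ω) ω

/-- number of excursions from `A` to the complement of `U`:
`N_{A,U} = sup {k ≥ 1 : D_k < ∞}` (with `sup ∅ = 0`). -/
noncomputable def Nexc (W : SRW d Ω) (A U : Set (Zd d)) (ω : Ω) : ℕ :=
  sSup {n | 0 < n ∧ W.Dt A U (n - 1) ω < ⊤}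

end SRW

end Disconnection

open Disconnection

namespace Disconnection
/-- unit vector -/
def ee {d : ℕ} (i : Fin d) : Zd d := fun j => if j = i then 1 else 0

/-- sum over neighbours -/
noncomputable def nb {d : ℕ} (u : Zd d → ℝ) (x : Zd d) : ℝ := ∑ i, (u (x + ee i) + u (x - ee i))

noncomputable def qq {d : ℕ} (x : Zd d) : ℝ := ∑ i, (x i : ℝ) ^ 2

lemma sum_ee {d : ℕ} (x : Zd d) (i : Fin d) (c : ℝ) :
    ∑ j, ((x j : ℝ) * (if j = i then c else 0)) = c * x i := by
  simp [mul_comm]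

lemma qq_add {d : ℕ} (x : Zd d) (i : Fin d) : qq (x + ee i) = qq x + 2 * x i + 1 := by
  have : ∀ j, (((x + ee i) j : ℤ) : ℝ) ^ 2
      = (x j : ℝ) ^ 2 + ((x j : ℝ) * (if j = i then 2 else 0)) + (if j = i then 1 else 0) := by
    intro j
    simp only [Pi.add_apply, ee]
    split_ifs <;> push_cast <;> ring
  unfold qq
  rw [Finset.sum_congr rfl (fun j _ => this j), Finset.sum_add_distrib, Finset.sum_add_distrib,
    sum_ee]
  simp

lemma qq_sub {d : ℕ} (x : Zd d) (i : Fin d) : qq (x - ee i) = qq x - 2 * x i + 1 := by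
  have : ∀ j, (((x - ee i) j : ℤ) : ℝ) ^ 2
      = (x j : ℝ) ^ 2 + ((x j : ℝ) * (if j = i then -2 else 0)) + (if j = i then 1 else 0) := by
    intro j
    simp only [Pi.sub_apply, ee]
    split_ifs <;> push_cast <;> ring
  unfold qq
  rw [Finset.sum_congr rfl (fun j _ => this j), Finset.sum_add_distrib, Finset.sum_add_distrib,
    sum_ee]
  simp; ring

lemma qq_nonneg {d : ℕ} (x : Zd d) : 0 ≤ qq x := Finset.sum_nonneg fun i _ => sq_nonneg _

lemma sq_le_qq {d : ℕ} (x : Zd d) (i : Fin d) : (x i : ℝ) ^ 2 ≤ qq x :=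
  Finset.single_le_sum (f := fun i => (x i : ℝ) ^ 2) (fun i _ => sq_nonneg _) (Finset.mem_univ i)

/-- scalar estimate -/
lemma scal1 (s t : ℝ) (hs : 0 < s) (ht : |t| ≤ 1 / 10) :
    (s * (1 + t)) ^ (-(1/4 : ℝ)) ≤ s ^ (-(1/4 : ℝ)) * (1 - t / 4 + 3 / 16 * t ^ 2) := by
  obtain ⟨h1, h2⟩ := abs_le.1 ht
  have hp : 0 < 1 - t / 4 + 3 / 16 * t ^ 2 := by nlinarith
  rw [Real.mul_rpow hs.le (by linarith)]
  refine mul_le_mul_of_nonneg_left ?_ (by positivity)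
  set p := 1 - t / 4 + 3 / 16 * t ^ 2 with hpdef
  have key : (p ^ 4)⁻¹ ≤ 1 + t := by
    rw [inv_le_iff_one_le_mul₀ (by positivity)]
    have e : (1 + t) * p ^ 4 - 1 = t ^ 2 * ((1/8) * t ^ 0 + (1/2) * t ^ 1 + (-69/256) * t ^ 2 + (61/256) * t ^ 3 + (-159/2048) * t ^ 4 + (135/4096) * t ^ 5 + (-351/65536) * t ^ 6 + (81/65536) * t ^ 7) := by
      rw [hpdef]; ring
    have hb : ∀ n : ℕ, |t ^ n| ≤ (1 / 10) ^ n := fun n => by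
      rw [abs_pow]; exact pow_le_pow_left₀ (abs_nonneg _) ht n
    have b1 := abs_le.1 (hb 1)
    have b2 := abs_le.1 (hb 2)
    have b3 := abs_le.1 (hb 3)
    have b4 := abs_le.1 (hb 4)
    have b5 := abs_le.1 (hb 5)
    have b6 := abs_le.1 (hb 6)
    have b7 := abs_le.1 (hb 7)
    have hpoly : 0 ≤ (1/8) * t ^ 0 + (1/2) * t ^ 1 + (-69/256) * t ^ 2 + (61/256) * t ^ 3 + (-159/2048) * t ^ 4 + (135/4096) * t ^ 5 + (-351/65536) * t ^ 6 + (81/65536) * t ^ 7 := by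
      norm_num at b1 b2 b3 b4 b5 b6 b7 ⊢
      linarith
    have := mul_nonneg (sq_nonneg t) hpoly
    linarith
  calc (1 + t) ^ (-(1/4 : ℝ)) ≤ ((p ^ 4)⁻¹) ^ (-(1/4 : ℝ)) := by
        apply Real.rpow_le_rpow_of_nonpos (by positivity) key (by norm_num)
    _ = p := by
        rw [Real.rpow_neg (by positivity), Real.inv_rpow (by positivity), inv_inv,
          ← Real.rpow_natCast, ← Real.rpow_mul hp.le]
        norm_num

lemma scal2 (s : ℝ) (hs : 1 < s) :
    s ^ (-(1/4 : ℝ)) * (1 + 1 / (4 * s)) ≤ (s - 1) ^ (-(1/4 : ℝ)) := by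
  have h0 : 0 < s := by linarith
  have e : s - 1 = s * (1 - 1 / s) := by field_simp
  have h1 : 0 < 1 - 1 / s := by rw [sub_pos, div_lt_one h0]; exact hs
  rw [e, Real.mul_rpow h0.le h1.le]
  refine mul_le_mul_of_nonneg_left ?_ (by positivity)
  set y := 1 / (4 * s) with hy
  have hy0 : 0 < y := by positivity
  have e2 : 1 - 1 / s = 1 - 4 * y := by rw [hy]; field_simp
  rw [e2] at h1 ⊢
  have key : 1 - 4 * y ≤ ((1 + y) ^ 4)⁻¹ := by
    rw [← one_div, le_div_iff₀ (by positivity)]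
    have : 0 ≤ 10 * y^2 + 20 * y^3 + 15 * y^4 + 4 * y^5 := by positivity
    nlinarith [this]
  calc 1 + y = (((1 + y) ^ 4)⁻¹) ^ (-(1/4 : ℝ)) := by
        rw [Real.rpow_neg (by positivity), Real.inv_rpow (by positivity), inv_inv,
          ← Real.rpow_natCast, ← Real.rpow_mul (by positivity)]
        norm_num
    _ ≤ _ := Real.rpow_le_rpow_of_nonpos h1 key (by norm_num)

noncomputable def ff {d : ℕ} (x : Zd d) : ℝ := (qq x + 100) ^ (-(1/4 : ℝ))

lemma ff_super {d : ℕ} (hd : 3 ≤ d) (x : Zd d) : nb ff x ≤ 2 * d * ff x := by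
  set s := qq x + 101 with hs
  have hq := qq_nonneg x
  have s0 : 0 < s := by linarith
  set P := s ^ (-(1/4 : ℝ)) with hP
  have P0 : 0 < P := by positivity
  have hd' : (3 : ℝ) ≤ d := by exact_mod_cast hd
  have h1 : ∀ i, ff (x + ee i) + ff (x - ee i) ≤ P * (2 + 3 / 2 * (x i : ℝ) ^ 2 / s ^ 2) := by
    intro i
    have hx := sq_le_qq x i
    have ht : |2 * (x i : ℝ) / s| ≤ 1 / 10 := by
      rw [abs_div, abs_of_pos s0, div_le_iff₀ s0, abs_le]
      constructor <;> nlinarith [sq_nonneg ((x i : ℝ) - 10), sq_nonneg ((x i : ℝ) + 10)]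
    have a := scal1 s _ s0 ht
    have b := scal1 s (-(2 * (x i : ℝ) / s)) s0 (by rwa [abs_neg])
    have ea : s * (1 + 2 * (x i : ℝ) / s) = qq (x + ee i) + 100 := by
      rw [qq_add]; field_simp; ring
    have eb : s * (1 + -(2 * (x i : ℝ) / s)) = qq (x - ee i) + 100 := by
      rw [qq_sub]; field_simp; ring
    rw [ea] at a
    rw [eb] at b
    refine (add_le_add a b).trans (le_of_eq ?_)
    field_simp; ring
  have h2 : nb ff x ≤ P * (2 * d + 3 / 2 * qq x / s ^ 2) := by
    refine (Finset.sum_le_sum fun i _ => h1 i).trans (le_of_eq ?_)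
    rw [← Finset.mul_sum, Finset.sum_add_distrib]
    simp only [Finset.sum_const, Finset.card_univ, Fintype.card_fin, nsmul_eq_mul,
      ← Finset.sum_div, ← Finset.mul_sum]
    unfold qq; ring
  have h3 := scal2 s (by linarith)
  have e3 : s - 1 = qq x + 100 := by rw [hs]; ring
  rw [e3] at h3
  have h4 : 2 * (d:ℝ) + 3 / 2 * qq x / s ^ 2 ≤ 2 * d * (1 + 1 / (4 * s)) := by
    have : 3 / 2 * qq x / s ^ 2 ≤ 2 * d * (1 / (4 * s)) := by
      rw [div_le_iff₀ (by positivity)]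
      have : 2 * (d:ℝ) * (1 / (4 * s)) * s ^ 2 = d * s / 2 := by field_simp; ring
      rw [this]; nlinarith
    linarith
  calc nb ff x ≤ P * (2 * d * (1 + 1 / (4 * s))) := h2.trans (mul_le_mul_of_nonneg_left h4 P0.le)
    _ = 2 * d * (P * (1 + 1 / (4 * s))) := by ring
    _ ≤ _ := mul_le_mul_of_nonneg_left h3 (by positivity)

lemma nb_mono_at {d : ℕ} {u v : Zd d → ℝ} (x : Zd d)
    (h1 : ∀ i, u (x + ee i) ≤ v (x + ee i)) (h2 : ∀ i, u (x - ee i) ≤ v (x - ee i)) :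
    nb u x ≤ nb v x := Finset.sum_le_sum fun i _ => add_le_add (h1 i) (h2 i)

lemma ff_pos {d : ℕ} (x : Zd d) : 0 < ff x := by
  have := qq_nonneg x
  unfold ff; positivity

/-- the barrier -/
lemma barrier {d : ℕ} (hd : 3 ≤ d) (L : ℕ) (hL : 1 ≤ L) (j : Fin d) (σ : ℤ) (hσ : σ ^ 2 = 1) :
    ∃ G : Zd d → ℝ, (∀ x, 0 ≤ G x) ∧ (∀ x, nb G x ≤ 2 * d * G x) ∧
      (∀ x, (∀ i, |x i| ≤ (L : ℤ)) → 1 ≤ G x) ∧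
      ∀ x : Zd d, 2 * (L : ℤ) + 1 ≤ σ * x j → G x ≤ 1 - 1 / (80 * d) := by
  have hd' : (3 : ℝ) ≤ d := by exact_mod_cast hd
  have hL' : (1 : ℝ) ≤ L := by exact_mod_cast hL
  have hσ' : (σ : ℝ) ^ 2 = 1 := by exact_mod_cast hσ
  set M : ℝ := 40 * d with hM
  set m : ℝ := (d * (L : ℝ) ^ 2 + 100) ^ (-(1/4 : ℝ)) with hm
  have m0 : 0 < m := by positivity
  set φ : Zd d → ℝ := fun x => 1 - (σ * x j - L) / (2 * (M - 1) * L) with hφ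
  have den : 0 < 2 * (M - 1) * L := by
    apply _root_.mul_pos _ (by linarith)
    linarith
  have hnbφ : ∀ x, nb φ x = 2 * d * φ x := by
    intro x
    have : ∀ i, φ (x + ee i) + φ (x - ee i) = 2 * φ x := by
      intro i
      simp only [hφ, Pi.add_apply, Pi.sub_apply]
      push_cast
      field_simp
      ring
    unfold nb
    rw [Finset.sum_congr rfl fun i _ => this i]
    simp; ring
  have hfar : ∀ x, M * L ≤ σ * x j → ff x / m ≤ 1 / 2 := by
    intro x hx
    have h1 : (M * L) ^ 2 ≤ qq x := by
      refine le_trans ?_ (sq_le_qq x j)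
      calc (M * L) ^ 2 ≤ (σ * x j : ℝ) ^ 2 := by
            apply pow_le_pow_left₀ (by positivity) hx
        _ = _ := by rw [mul_pow, hσ', one_mul]
    have h2 : 16 * (d * (L : ℝ) ^ 2 + 100) ≤ qq x + 100 := by
      have : 16 * (d * (L : ℝ) ^ 2 + 100) ≤ (M * L) ^ 2 + 100 := by
        rw [hM]
        have : 1 ≤ (L:ℝ)^2 := by nlinarith
        nlinarith [mul_le_mul_of_nonneg_left this (show (0:ℝ) ≤ d^2 by positivity), mul_le_mul_of_nonneg_left hd' (show (0:ℝ) ≤ d * L^2 by positivity)]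
      linarith
    rw [div_le_iff₀ m0]
    calc ff x ≤ (16 * (d * (L : ℝ) ^ 2 + 100)) ^ (-(1/4 : ℝ)) :=
          Real.rpow_le_rpow_of_nonpos (by positivity) h2 (by norm_num)
      _ = 1 / 2 * m := by
          rw [Real.mul_rpow (by norm_num) (by positivity)]
          congr 1
          rw [show (16 : ℝ) = 2 ^ (4 : ℝ) by norm_num, ← Real.rpow_mul (by norm_num)]
          norm_num
          
  set G : Zd d → ℝ := fun x => min (ff x / m) (max (φ x) (1 / 2)) with hG
  have hGf : ∀ x, G x ≤ ff x / m := fun x => min_le_left _ _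
  have hnbf : ∀ x, nb G x ≤ 2 * d * (ff x / m) := by
    intro x
    calc nb G x ≤ nb (fun y => ff y / m) x := nb_mono_at x (fun i => hGf _) (fun i => hGf _)
      _ = nb ff x / m := by
        unfold nb; rw [Finset.sum_div]; exact Finset.sum_congr rfl fun i _ => by ring
      _ ≤ (2 * d * ff x) / m := by gcongr; exact ff_super hd x
      _ = _ := by ring
  refine ⟨G, ?_, ?_, ?_, ?_⟩
  · intro x
    exact le_min (div_nonneg (ff_pos x).le m0.le) (le_max_of_le_right (by norm_num))
  · intro x
    by_cases hx : M * L ≤ σ * x j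
    · have : G x = ff x / m := min_eq_left ((hfar x hx).trans (le_max_right _ _))
      rw [this]; exact hnbf x
    · push Not at hx
      have hZ : σ * x j + 1 ≤ 40 * d * L := by
        have : ((σ * x j : ℤ) : ℝ) < ((40 * d * L : ℤ) : ℝ) := by push_cast; rw [← hM]; exact hx
        have := Int.cast_lt.1 this
        omega
      have hσ1 : |σ| = 1 := by
        rcases sq_eq_one_iff.1 hσ with h | h <;> simp [h]
      have hnear : ∀ y : Zd d, σ * y j ≤ 40 * d * L → 1 / 2 ≤ φ y := by
        intro y hy
        have : ((σ * y j : ℤ) : ℝ) ≤ ((40 * d * L : ℤ) : ℝ) := Int.cast_le.2 hy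
        push_cast at this
        have : (σ * y j - L : ℝ) / (2 * (M - 1) * L) ≤ 1 / 2 := by
          rw [div_le_iff₀ den, hM]; linarith
        simp only [hφ]; linarith
      have hG2 : ∀ y : Zd d, σ * y j ≤ 40 * d * L → G y ≤ φ y := by
        intro y hy
        exact (min_le_right _ _).trans (max_le le_rfl (hnear y hy))
      have hb : ∀ i : Fin d, σ * ee i j ≤ 1 ∧ -1 ≤ σ * ee i j := by
        intro i
        have := abs_le.1 hσ1.le
        unfold ee; split_ifs <;> simp <;> omega
      have hGphi : nb G x ≤ 2 * d * φ x := by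
        rw [← hnbφ]
        apply nb_mono_at
        · intro i; apply hG2; rw [Pi.add_apply, mul_add]; linarith [hb i]
        · intro i; apply hG2; rw [Pi.sub_apply, mul_sub]; linarith [hb i]
      have hx' : 1 / 2 ≤ φ x := hnear x (by linarith)
      have : G x = min (ff x / m) (φ x) := by simp only [hG]; rw [max_eq_left hx']
      rw [this, mul_min_of_nonneg _ _ (by positivity)]
      exact le_min (hnbf x) hGphi
  · intro x hx
    have hq : qq x ≤ d * (L:ℝ)^2 := by
      have : ∀ i, (x i : ℝ) ^ 2 ≤ (L:ℝ)^2 := by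
        intro i
        rw [← sq_abs]
        have : (|x i| : ℝ) ≤ L := by exact_mod_cast hx i
        exact pow_le_pow_left₀ (abs_nonneg _) this 2
      refine (Finset.sum_le_sum fun i _ => this i).trans (le_of_eq ?_)
      simp
    have hσ1 : |σ| = 1 := by
      rcases sq_eq_one_iff.1 hσ with h | h <;> simp [h]
    refine le_min ?_ (le_max_of_le_left ?_)
    · rw [le_div_iff₀ m0, one_mul]
      apply Real.rpow_le_rpow_of_nonpos _ (by linarith) (by norm_num)
      have := qq_nonneg x; linarith
    · have h1 : σ * x j ≤ L := by
        calc σ * x j ≤ |σ * x j| := le_abs_self _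
          _ = |x j| := by rw [abs_mul, hσ1, one_mul]
          _ ≤ L := hx j
      have h2 : (σ * x j : ℝ) ≤ L := by exact_mod_cast h1
      have : (σ * x j - L : ℝ) / (2 * (M - 1) * L) ≤ 0 := div_nonpos_of_nonpos_of_nonneg (by linarith) den.le
      simp only [hφ]; linarith
  · intro x hx
    have h2 : 2 * (L:ℝ) + 1 ≤ (σ * x j : ℝ) := by exact_mod_cast hx
    refine (min_le_right _ _).trans (max_le ?_ ?_)
    · have : 1 / (80 * d : ℝ) ≤ (σ * x j - L : ℝ) / (2 * (M - 1) * L) := by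
        rw [div_le_div_iff₀ (by positivity) den, hM]
        nlinarith
      simp only [hφ]; linarith
    · have : 1 / (80 * d : ℝ) ≤ 1 / 2 := by
        apply one_div_le_one_div_of_le <;> linarith
      linarith
end Disconnection

namespace Disconnection

/-- signed unit vector -/
def vv {d : ℕ} (e : Fin d × Bool) : Zd d := if e.2 then ee e.1 else - ee e.1

def ng {d : ℕ} (e : Fin d × Bool) : Fin d × Bool := (e.1, !e.2)

lemma vv_ng {d : ℕ} (e : Fin d × Bool) : vv (ng e) = - vv e := by
  rcases e with ⟨i, b⟩; cases b <;> simp [vv, ng]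

lemma nb_eq {d : ℕ} (u : Zd d → ℝ) (x : Zd d) : nb u x = ∑ e : Fin d × Bool, u (x + vv e) := by
  rw [Fintype.sum_prod_type]
  simp [nb, vv, sub_eq_add_neg]

noncomputable def aa {d : ℕ} (u : Zd d → ℝ) (x : Zd d) (e : Fin d × Bool) : ℝ :=
  √(u (x + vv e)) / √(u x)

noncomputable def gg {d : ℕ} (u : Zd d → ℝ) (x : Zd d) : ℝ := ∑ e, (1 - aa u x e)

section
variable {d : ℕ} {u : Zd d → ℝ} (hu : ∀ x, 0 < u x)
include hu

lemma aa_pos (x : Zd d) (e : Fin d × Bool) : 0 < aa u x e :=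
  div_pos (Real.sqrt_pos.2 (hu _)) (Real.sqrt_pos.2 (hu _))

lemma aa_sq_sum (x : Zd d) (hx : nb u x = 2 * d * u x) : ∑ e, aa u x e ^ 2 = 2 * d := by
  have : ∀ e, aa u x e ^ 2 = u (x + vv e) / u x := by
    intro e
    rw [aa, div_pow, Real.sq_sqrt (hu _).le, Real.sq_sqrt (hu _).le]
  rw [Finset.sum_congr rfl fun e _ => this e, ← Finset.sum_div, ← nb_eq, hx,
    mul_div_assoc, div_self (hu x).ne', mul_one]

lemma card_E : ∑ _e : Fin d × Bool, (1 : ℝ) = 2 * d := by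
  simp [mul_comm]

lemma two_gg (x : Zd d) (hx : nb u x = 2 * d * u x) : ∑ e, (aa u x e - 1) ^ 2 = 2 * gg u x := by
  have h1 := aa_sq_sum hu x hx
  have h2 := card_E hu
  have : ∀ e, (aa u x e - 1) ^ 2 = aa u x e ^ 2 - 1 + 2 * (1 - aa u x e) := fun e => by ring
  rw [Finset.sum_congr rfl fun e _ => this e, Finset.sum_add_distrib, Finset.sum_sub_distrib, h1, h2,
    ← Finset.mul_sum, gg]
  ring

lemma gg_nonneg (x : Zd d) (hx : nb u x = 2 * d * u x) : 0 ≤ gg u x := by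
  have := two_gg hu x hx
  have h2 : 0 ≤ ∑ e, (aa u x e - 1) ^ 2 := Finset.sum_nonneg fun e _ => sq_nonneg _
  linarith

lemma gg_le (x : Zd d) : gg u x ≤ 2 * d := by
  rw [← card_E hu]
  exact Finset.sum_le_sum fun e _ => by linarith [aa_pos hu x e]

omit hu in
lemma two_var (p q : ℝ) (hp : 0 < p) (hq : 0 < q) :
    (max (2 - p - q) 0) ^ 2 / 4 ≤ (p * (q - 1 / p) ^ 2 + q * (p - 1 / q) ^ 2) / 2 := by
  have e : p * (q - 1 / p) ^ 2 + q * (p - 1 / q) ^ 2 = (1 - p * q) ^ 2 * ((p + q) / (p * q)) := by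
    field_simp; ring
  rw [e]
  by_cases h : 2 - p - q ≤ 0
  · rw [max_eq_right h]
    have : 0 ≤ (1 - p * q) ^ 2 * ((p + q) / (p * q)) := by positivity
    simp; linarith
  · push Not at h
    rw [max_eq_left h.le]
    have h1 : 2 ≤ (p + q) / (p * q) := by
      rw [le_div_iff₀ (by positivity)]
      nlinarith [sq_nonneg (p - q), mul_pos hp hq]
    have h2 : (2 - p - q) / 2 ≤ 1 - p * q := by
      nlinarith [sq_nonneg (p - q)]
    have h3 : ((2 - p - q) / 2) ^ 2 ≤ (1 - p * q) ^ 2 := pow_le_pow_left₀ (by linarith) h2 2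
    have h4 : (1 - p * q) ^ 2 * 2 ≤ (1 - p * q) ^ 2 * ((p + q) / (p * q)) :=
      mul_le_mul_of_nonneg_left h1 (sq_nonneg _)
    nlinarith

lemma key_ineq (hd : 0 < d) (x : Zd d) (hx : nb u x = 2 * d * u x)
    (hx' : ∀ e, nb u (x + vv e) = 2 * d * u (x + vv e)) :
    gg u x ^ 2 / (4 * d) ≤ ∑ e, aa u x e ^ 2 * (gg u (x + vv e) - gg u x) := by
  have hd' : (0 : ℝ) < d := by exact_mod_cast hd
  have A2 := aa_sq_sum hu x hx
  have cE := card_E hu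
  have comm : ∀ e e', aa u x e * aa u (x + vv e) e' = aa u x e' * aa u (x + vv e') e := by
    intro e e'
    have h0 := fun y => (Real.sqrt_pos.2 (hu y)).ne'
    unfold aa
    rw [show x + vv e' + vv e = x + vv e + vv e' by abel]
    have := h0 x
    have := h0 (x + vv e)
    have := h0 (x + vv e')
    field_simp
  have e1 : ∑ e, aa u x e ^ 2 * (gg u (x + vv e) - gg u x)
      = ∑ e', aa u x e' * (1 / 2 * ∑ e, (aa u x e - aa u (x + vv e') e) ^ 2) := by
    have r1 : ∀ e', aa u x e' * (1 / 2 * ∑ e, (aa u x e - aa u (x + vv e') e) ^ 2)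
        = 2 * d * aa u x e' - ∑ e, aa u x e ^ 2 * aa u (x + vv e) e' := by
      intro e'
      have : ∀ e, (aa u x e - aa u (x + vv e') e) ^ 2 
        = aa u x e ^ 2 + aa u (x + vv e') e ^ 2 - 2 * (aa u x e * aa u (x + vv e') e) := fun e => by ring
      rw [Finset.sum_congr rfl fun e _ => this e, Finset.sum_sub_distrib, Finset.sum_add_distrib, A2,
        aa_sq_sum hu _ (hx' e'), ← Finset.mul_sum]
      have : ∑ e, aa u x e ^ 2 * aa u (x + vv e) e' 
          = aa u x e' * ∑ e, aa u x e * aa u (x + vv e') e := by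
        rw [Finset.mul_sum]
        refine Finset.sum_congr rfl fun e _ => ?_
        rw [sq, mul_assoc, comm e e']; ring
      rw [this]; ring
    rw [Finset.sum_congr rfl fun e _ => r1 e, Finset.sum_sub_distrib, Finset.sum_comm]
    have r2 : ∀ e, aa u x e ^ 2 * (gg u (x + vv e) - gg u x)
      = aa u x e ^ 2 * (2 * d) - ∑ e', aa u x e ^ 2 * aa u (x + vv e) e' - aa u x e ^ 2 * gg u x := by
      intro e
      rw [← Finset.mul_sum, mul_sub]
      congr 1
      rw [gg, Finset.sum_sub_distrib, cE]; ring
    rw [Finset.sum_congr rfl fun e _ => r2 e, Finset.sum_sub_distrib, Finset.sum_sub_distrib,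
      ← Finset.sum_mul, ← Finset.sum_mul, A2, gg, Finset.sum_sub_distrib, cE, ← Finset.mul_sum]
    ring
  rw [e1]
  have inv : ∀ e, aa u (x + vv e) (ng e) = 1 / aa u x e := by
    intro e
    unfold aa
    rw [vv_ng, add_neg_cancel_right, one_div_div]
  have e2 : ∑ e', aa u x e' * (1 / 2 * (aa u x (ng e') - 1 / aa u x e') ^ 2) ≤
      ∑ e', aa u x e' * (1 / 2 * ∑ e, (aa u x e - aa u (x + vv e') e) ^ 2) := by
    refine Finset.sum_le_sum fun e' _ => ?_
    refine mul_le_mul_of_nonneg_left ?_ (aa_pos hu x e').le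
    refine mul_le_mul_of_nonneg_left ?_ (by norm_num)
    rw [← inv]
    exact Finset.single_le_sum (f := fun e => (aa u x e - aa u (x + vv e') e) ^ 2)
      (fun e _ => sq_nonneg _) (Finset.mem_univ (ng e'))
  refine le_trans ?_ e2
  set s : Fin d → ℝ := fun i => 2 - aa u x (i, true) - aa u x (i, false) with hs
  have gs : gg u x = ∑ i, s i := by
    rw [gg, Fintype.sum_prod_type]
    refine Finset.sum_congr rfl fun i _ => ?_
    simp [hs]; ring
  have g0 := gg_nonneg hu x hx
  have g1 : gg u x ≤ ∑ i, max (s i) 0 := by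
    rw [gs]; exact Finset.sum_le_sum fun i _ => le_max_left _ _
  have g2 : (∑ i, max (s i) 0) ^ 2 ≤ d * ∑ i, (max (s i) 0) ^ 2 := by
    have := sq_sum_le_card_mul_sum_sq (s := Finset.univ) (f := fun i => max (s i) 0)
    simpa using this
  have g3 : ∑ i, (max (s i) 0) ^ 2 / 4 ≤ 
      ∑ e', aa u x e' * (1 / 2 * (aa u x (ng e') - 1 / aa u x e') ^ 2) := by
    rw [Fintype.sum_prod_type]
    refine Finset.sum_le_sum fun i _ => ?_
    refine (two_var _ _ (aa_pos hu x (i, true)) (aa_pos hu x (i, false))).trans (le_of_eq ?_)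
    simp [ng]; ring
  refine le_trans ?_ g3
  rw [← Finset.sum_div, div_le_div_iff₀ (by positivity) (by norm_num)]
  have : gg u x ^ 2 ≤ (∑ i, max (s i) 0) ^ 2 := pow_le_pow_left₀ g0 g1 2
  nlinarith
end

noncomputable def CC (d : ℕ) : ℝ := 8 * d * (1152 * d ^ 2 + 184 * d)

def etaZ {d : ℕ} (x : Zd d) (e : Fin d × Bool) : ℤ := if e.2 then 2 * x e.1 + 1 else - 2 * x e.1 + 1

lemma qq_vv {d : ℕ} (x : Zd d) (e : Fin d × Bool) : qq (x + vv e) = qq x + etaZ x e := by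
  rcases e with ⟨i, b⟩
  cases b
  · simp only [vv, etaZ, Bool.false_eq_true, if_false, ← sub_eq_add_neg, qq_sub]; push_cast; ring
  · simp only [vv, etaZ, if_true, qq_add]; push_cast; ring

lemma sum_eta {d : ℕ} (x : Zd d) : ∑ e, (etaZ x e : ℝ) = 2 * d := by
  rw [Fintype.sum_prod_type]
  have : ∀ i, ∑ b, (etaZ x (i, b) : ℝ) = 2 := by
    intro i; simp [etaZ]; ring
  rw [Finset.sum_congr rfl fun i _ => this i]; simp; ring

lemma fin_qq {d : ℕ} (R : ℕ) : {x : Zd d | qq x < (R:ℝ)^2}.Finite := by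
  refine (Set.finite_Icc (fun _ => -(R:ℤ) : Zd d) (fun _ => (R:ℤ))).subset ?_
  intro x hx
  have h : ∀ i, |x i| ≤ (R:ℤ) := by
    intro i
    have := (sq_le_qq x i).trans hx.le
    have : (x i) ^ 2 ≤ (R:ℤ)^2 := by exact_mod_cast this
    exact abs_le_of_sq_le_sq this (by positivity)
  exact ⟨fun i => (abs_le.1 (h i)).1, fun i => (abs_le.1 (h i)).2⟩

lemma abs_vv {d : ℕ} (e : Fin d × Bool) (i : Fin d) : |vv e i| ≤ 1 := by
  rcases e with ⟨j, b⟩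
  cases b <;> simp [vv, ee] <;> split_ifs <;> simp

lemma max_pr {d : ℕ} (hd : 0 < d) {u : Zd d → ℝ} (hu : ∀ x, 0 < u x) (R : ℕ) (hR : 1 ≤ R)
    (hh : ∀ x : Zd d, (∀ i, |x i| ≤ (R:ℤ)) → nb u x = 2 * d * u x) :
    ∀ x, qq x < (R:ℝ)^2 → ((R:ℝ)^2 - qq x)^2 * gg u x ≤ CC d * R^2 := by
  have hd' : (1 : ℝ) ≤ d := by exact_mod_cast hd
  have hR' : (1 : ℝ) ≤ R := by exact_mod_cast hR
  obtain ⟨x, hx, hmax⟩ := Set.exists_max_image {x : Zd d | qq x < (R:ℝ)^2}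
    (fun x => ((R:ℝ)^2 - qq x)^2 * gg u x) (fin_qq R) ⟨0, by
      show qq (0 : Zd d) < (R:ℝ)^2
      have : qq (0 : Zd d) = 0 := by simp [qq]
      rw [this]; positivity⟩
  intro y hy
  refine (hmax y hy).trans ?_
  simp only [mem_ofPred_eq] at hx hmax ⊢
  have hxi : ∀ i, |x i| < (R:ℤ) := by
    intro i
    have := (sq_le_qq x i).trans_lt hx
    have : (x i) ^ 2 < (R:ℤ)^2 := by exact_mod_cast this
    exact abs_lt_of_sq_lt_sq this (by positivity)
  have harx := hh x (fun i => (hxi i).le)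
  have hary : ∀ e, nb u (x + vv e) = 2 * d * u (x + vv e) := by
    intro e
    apply hh
    intro i
    have h1 := abs_add_le (x i) (vv e i)
    have h2 := abs_vv e i
    have h3 := hxi i
    simp only [Pi.add_apply]; omega
  set D := (R:ℝ)^2 - qq x with hD
  have D0 : 0 < D := by linarith
  have DR : D ≤ (R:ℝ)^2 := by linarith [qq_nonneg x]
  set g := gg u x with hg
  have g0 : 0 ≤ g := gg_nonneg hu x harx
  by_cases hc : D ≤ 8 * R
  · have h1 : D ^ 2 ≤ (8 * R)^2 := pow_le_pow_left₀ D0.le hc 2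
    have h2 : g ≤ 2 * d := gg_le hu x
    have h3 : D ^ 2 * g ≤ (8 * R)^2 * (2 * d) := mul_le_mul h1 h2 g0 (by positivity)
    refine h3.trans ?_
    rw [CC]
    have : 128 * (d:ℝ) ≤ 8 * d * (1152 * d ^ 2 + 184 * d) := by nlinarith
    nlinarith [mul_le_mul_of_nonneg_right this (show (0:ℝ) ≤ (R:ℝ)^2 by positivity)]
  push Not at hc
  rcases g0.eq_or_lt with h0 | gpos
  · rw [← h0, mul_zero, CC]; positivity
  have eta_b : ∀ e, |(etaZ x e : ℝ)| ≤ 3 * R := by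
    intro e
    have : |etaZ x e| ≤ 3 * R := by
      have h3 := abs_lt.1 (hxi e.1)
      rw [etaZ, abs_le]; split_ifs <;> omega
    exact_mod_cast this
  set τ : Fin d × Bool → ℝ := fun e => etaZ x e / D with hτ
  set T : ℝ := 9 * R ^ 2 / D ^ 2 with hT
  have T0 : 0 ≤ T := by positivity
  have tau_sq : ∀ e, τ e ^ 2 ≤ T := by
    intro e
    simp only [hτ, hT, div_pow]
    gcongr
    rw [← sq_abs]
    calc |(etaZ x e : ℝ)| ^ 2 ≤ (3 * R) ^ 2 := pow_le_pow_left₀ (abs_nonneg _) (eta_b e) 2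
      _ = _ := by ring
  have tau_b : ∀ e, |τ e| ≤ 3 / 8 := by
    intro e
    simp only [hτ]
    rw [abs_div, abs_of_pos D0, div_le_iff₀ D0]
    linarith [eta_b e]
  have hstep : ∀ e, gg u (x + vv e) - g ≤ g * (2 * τ e + 10 * τ e ^ 2) := by
    intro e
    obtain ⟨b1, b2⟩ := abs_le.1 (tau_b e)
    have Dy : (R:ℝ)^2 - qq (x + vv e) = D * (1 - τ e) := by
      rw [qq_vv]; simp only [hτ]; field_simp; rw [hD]; ring
    have pos : 0 < D * (1 - τ e) := _root_.mul_pos D0 (by linarith)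
    have := hmax (x + vv e) (by linarith)
    rw [Dy, mul_pow, mul_assoc] at this
    have h1 : (1 - τ e)^2 * gg u (x + vv e) ≤ g := le_of_mul_le_mul_left this (by positivity)
    have h2 : 0 < (1 - τ e)^2 := by apply pow_pos; linarith
    have h3 : 1 ≤ (1 - τ e)^2 * (1 + 2 * τ e + 10 * τ e ^ 2) := by
      have : (1 - τ e)^2 * (1 + 2 * τ e + 10 * τ e ^ 2) - 1
        = τ e ^ 2 * (7 - 18 * τ e + 10 * τ e ^ 2) := by ring
      have : 0 ≤ τ e ^ 2 * (7 - 18 * τ e + 10 * τ e ^ 2) := 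
        mul_nonneg (sq_nonneg _) (by nlinarith [sq_nonneg (τ e - 3/8)])
      linarith
    have h4 : (1 - τ e)^2 * gg u (x + vv e) ≤ (1 - τ e)^2 * (g * (1 + 2 * τ e + 10 * τ e ^ 2)) := by
      calc _ ≤ g * 1 := by linarith
        _ ≤ g * ((1 - τ e)^2 * (1 + 2 * τ e + 10 * τ e ^ 2)) := mul_le_mul_of_nonneg_left h3 g0
        _ = _ := by ring
    have := le_of_mul_le_mul_left h4 h2
    linarith
  have hk := key_ineq hu hd x harx hary
  have hk2 : g ^ 2 / (4 * d) ≤ g * ∑ e, aa u x e ^ 2 * (2 * τ e + 10 * τ e ^ 2) := by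
    refine hk.trans ?_
    rw [Finset.mul_sum]
    refine Finset.sum_le_sum fun e _ => ?_
    calc aa u x e ^ 2 * (gg u (x + vv e) - gg u x) 
        ≤ aa u x e ^ 2 * (g * (2 * τ e + 10 * τ e ^ 2)) :=
          mul_le_mul_of_nonneg_left (hstep e) (sq_nonneg _)
      _ = _ := by ring
  have hk3 : g / (4 * d) ≤ ∑ e, aa u x e ^ 2 * (2 * τ e + 10 * τ e ^ 2) := by
    rw [show g ^ 2 / (4 * d) = g * (g / (4 * d)) by ring] at hk2
    exact le_of_mul_le_mul_left hk2 gpos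
  have term : ∀ e, aa u x e ^ 2 * (2 * τ e + 10 * τ e ^ 2) ≤
      2 * τ e + 1 / (16 * d) * (aa u x e - 1) ^ 2 + 16 * d * T * (2 * aa u x e ^ 2 + 2) 
        + 10 * T * aa u x e ^ 2 := by
    intro e
    set a := aa u x e
    set t := τ e
    have t2 : t ^ 2 ≤ T := tau_sq e
    have q1 : 2 * t * (a ^ 2 - 1) ≤ 1 / (16 * d) * (a - 1) ^ 2 + 16 * d * ((a + 1) ^ 2 * t ^ 2) := by
      have : 0 ≤ 1 / (16 * d) * ((a - 1) - 16 * d * ((a + 1) * t)) ^ 2 := by positivity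
      have e : 1 / (16 * d) * ((a - 1) - 16 * d * ((a + 1) * t)) ^ 2 
        = 1 / (16 * d) * (a - 1) ^ 2 + 16 * d * ((a + 1) ^ 2 * t ^ 2) - 2 * t * (a ^ 2 - 1) := by
        field_simp; ring
      linarith
    have q2 : (a + 1) ^ 2 * t ^ 2 ≤ (2 * a ^ 2 + 2) * T := by
      apply mul_le_mul _ t2 (sq_nonneg _) (by positivity)
      nlinarith [sq_nonneg (a - 1)]
    have q3 : 16 * d * ((a + 1) ^ 2 * t ^ 2) ≤ 16 * d * ((2 * a ^ 2 + 2) * T) :=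
      mul_le_mul_of_nonneg_left q2 (by positivity)
    have q4 : a ^ 2 * (10 * t ^ 2) ≤ a ^ 2 * (10 * T) := 
      mul_le_mul_of_nonneg_left (by linarith) (sq_nonneg _)
    nlinarith
  have hsum : ∑ e, (2 * τ e + 1 / (16 * d) * (aa u x e - 1) ^ 2 
        + 16 * d * T * (2 * aa u x e ^ 2 + 2) + 10 * T * aa u x e ^ 2)
      = 4 * d / D + g / (8 * d) + (128 * d ^ 2 + 20 * d) * T := by
    have a1 := aa_sq_sum hu x harx
    have a2 := two_gg hu x harx
    have a3 : ∑ e, τ e = 2 * d / D := by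
      simp only [hτ]; rw [← Finset.sum_div, sum_eta]
    have a4 : ∑ e, (2 * aa u x e ^ 2 + 2) = 8 * (d:ℝ) := by
      rw [Finset.sum_add_distrib, ← Finset.mul_sum, a1]; simp; ring
    rw [Finset.sum_add_distrib, Finset.sum_add_distrib, Finset.sum_add_distrib, ← Finset.mul_sum,
      ← Finset.mul_sum, ← Finset.mul_sum, ← Finset.mul_sum, a1, a2, a3, a4, ← hg]
    field_simp; ring
  have hfin : g / (4 * d) ≤ 4 * d / D + g / (8 * d) + (128 * d ^ 2 + 20 * d) * T :=
    hk3.trans ((Finset.sum_le_sum fun e _ => term e).trans hsum.le)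
  have h5 : 4 * d / D ≤ 4 * d * (R ^ 2 / D ^ 2) := by
    rw [div_le_iff₀ D0]
    have : 1 ≤ R ^ 2 / D ^ 2 * D := by
      rw [show (R:ℝ) ^ 2 / D ^ 2 * D = R ^ 2 / D by field_simp, le_div_iff₀ D0]; linarith
    nlinarith
  have h6 : g / (8 * d) ≤ (4 * d + 9 * (128 * d ^ 2 + 20 * d)) * (R ^ 2 / D ^ 2) := by
    have : g / (4 * d) = 2 * (g / (8 * d)) := by field_simp; ring
    have : T = 9 * (R ^ 2 / D ^ 2) := by rw [hT]; ring
    nlinarith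
  rw [div_le_iff₀ (by positivity)] at h6
  calc D ^ 2 * g ≤ D ^ 2 * _ := mul_le_mul_of_nonneg_left h6 (by positivity)
    _ = _ := by rw [CC]; field_simp; ring

noncomputable def C1 (d : ℕ) : ℝ := √(8 * CC d)

lemma step_bd {d : ℕ} (hd : 0 < d) {u : Zd d → ℝ} (hu : ∀ x, 0 < u x) (R : ℕ) (hR : 1 ≤ R)
    (hh : ∀ x : Zd d, (∀ i, |x i| ≤ (R:ℤ)) → nb u x = 2 * d * u x) (x : Zd d)
    (hx : 2 * qq x ≤ (R:ℝ)^2) (e : Fin d × Bool) :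
    |√(u (x + vv e)) - √(u x)| ≤ C1 d / R * √(u x) := by
  have hR' : (1 : ℝ) ≤ R := by exact_mod_cast hR
  have hlt : qq x < (R:ℝ)^2 := by nlinarith [qq_nonneg x]
  have h1 := max_pr hd hu R hR hh x hlt
  have harx : nb u x = 2 * d * u x := by
    apply hh
    intro i
    have := (sq_le_qq x i).trans hlt.le
    have : (x i) ^ 2 ≤ (R:ℤ)^2 := by exact_mod_cast this
    exact abs_le_of_sq_le_sq this (by positivity)
  have g0 := gg_nonneg hu x harx
  have h2 : ((R:ℝ)^2/2)^2 * gg u x ≤ CC d * R^2 := by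
    refine le_trans (mul_le_mul_of_nonneg_right ?_ g0) h1
    exact pow_le_pow_left₀ (by positivity) (by linarith) 2
  have h3 : 2 * gg u x ≤ 8 * CC d / R ^ 2 := by
    rw [le_div_iff₀ (by positivity)]
    have : (R:ℝ)^2 * (2 * gg u x * R ^ 2) ≤ R^2 * (8 * CC d) := by nlinarith
    exact le_of_mul_le_mul_left this (by positivity)
  have h4 : (aa u x e - 1) ^ 2 ≤ 8 * CC d / R ^ 2 := by
    refine le_trans ?_ h3
    rw [← two_gg hu x harx]
    exact Finset.single_le_sum (f := fun e => (aa u x e - 1) ^ 2)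
      (fun e _ => sq_nonneg _) (Finset.mem_univ e)
  have h5 : |aa u x e - 1| ≤ C1 d / R := by
    rw [← Real.sqrt_sq_eq_abs]
    refine (Real.sqrt_le_sqrt h4).trans (le_of_eq ?_)
    rw [Real.sqrt_div' _ (by positivity), Real.sqrt_sq (by positivity), C1]
  have hs := Real.sqrt_pos.2 (hu x)
  have : √(u (x + vv e)) - √(u x) = (aa u x e - 1) * √(u x) := by
    rw [aa]; field_simp
  rw [this, abs_mul, abs_of_pos hs]
  exact mul_le_mul_of_nonneg_right h5 hs.le

def l1 {d : ℕ} (x : Zd d) : ℕ := ∑ i, (x i).natAbs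

lemma exists_pred {d : ℕ} (y : Zd d) (n : ℕ) (hy : l1 y = n + 1) :
    ∃ y' e, y = y' + vv e ∧ l1 y' = n ∧ qq y' ≤ qq y := by
  have : ∃ i, y i ≠ 0 := by
    by_contra h
    push Not at h
    simp [l1, h] at hy
  obtain ⟨i, hi⟩ := this
  have gen : ∀ y' : Zd d, (∀ j, j ≠ i → y' j = y j) → (y' i).natAbs + 1 = (y i).natAbs →
      l1 y' = n ∧ qq y' ≤ qq y := by
    intro y' h1 h2
    constructor
    · have a := Finset.add_sum_erase Finset.univ (fun j => (y j).natAbs) (Finset.mem_univ i)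
      have b := Finset.add_sum_erase Finset.univ (fun j => (y' j).natAbs) (Finset.mem_univ i)
      have c : ∑ j ∈ Finset.univ.erase i, (y' j).natAbs = ∑ j ∈ Finset.univ.erase i, (y j).natAbs :=
        Finset.sum_congr rfl fun j hj => by rw [h1 j (Finset.ne_of_mem_erase hj)]
      unfold l1 at *
      omega
    · refine Finset.sum_le_sum fun j _ => ?_
      by_cases hj : j = i
      · subst hj
        have : |y' j| ≤ |y j| := by rw [Int.abs_eq_natAbs, Int.abs_eq_natAbs]; omega
        have := sq_le_sq.2 this
        exact_mod_cast this
      · rw [h1 j hj]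
  rcases lt_or_gt_of_ne hi with h | h
  · refine ⟨y + ee i, (i, false), by simp [vv], gen _ ?_ ?_⟩
    · intro j hj; simp [ee, hj]
    · simp [ee]; omega
  · refine ⟨y - ee i, (i, true), by simp [vv], gen _ ?_ ?_⟩
    · intro j hj; simp [ee, hj]
    · simp [ee]; omega

lemma chain {d : ℕ} (hd : 0 < d) {u : Zd d → ℝ} (hu : ∀ x, 0 < u x) (R : ℕ) (hR : 1 ≤ R)
    (hh : ∀ x : Zd d, (∀ i, |x i| ≤ (R:ℤ)) → nb u x = 2 * d * u x) (hC : C1 d / R ≤ 1) (n : ℕ) :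
    ∀ y : Zd d, 2 * qq y ≤ (R:ℝ)^2 → l1 y = n → 
      √(u y) ≤ (1 + C1 d / R) ^ n * √(u 0) ∧ (1 - C1 d / R) ^ n * √(u 0) ≤ √(u y) := by
  have hC0 : 0 ≤ C1 d / R := by unfold C1; positivity
  induction n with
  | zero =>
    intro y _ hy
    have : y = 0 := by
      funext i
      have := (Finset.sum_eq_zero_iff.1 hy) i (Finset.mem_univ i)
      simpa using this
    subst this; simp
  | succ n ih =>
    intro y hq hy
    obtain ⟨y', e, rfl, h1, h2⟩ := exists_pred y n hy
    obtain ⟨i1, i2⟩ := ih y' (by linarith) h1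
    obtain ⟨s1, s2⟩ := abs_le.1 (step_bd hd hu R hR hh y' (by linarith) e)
    constructor
    · calc √(u (y' + vv e)) ≤ (1 + C1 d / R) * √(u y') := by linarith
        _ ≤ (1 + C1 d / R) * _ := mul_le_mul_of_nonneg_left i1 (by linarith)
        _ = _ := by ring
    · calc _ = (1 - C1 d / R) * ((1 - C1 d / R) ^ n * √(u 0)) := by ring
        _ ≤ (1 - C1 d / R) * √(u y') := mul_le_mul_of_nonneg_left i2 (by linarith)
        _ ≤ _ := by linarith

lemma grad_pos {d : ℕ} (hd : 0 < d) {u : Zd d → ℝ} (hu : ∀ x, 0 < u x) (L K : ℕ) (hL : 1 ≤ L)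
    (hK : 18 * (d:ℝ) + 6 * d * C1 d ≤ K)
    (hh : ∀ x : Zd d, (∀ i, |x i| ≤ ((K * L : ℕ):ℤ)) → nb u x = 2 * d * u x) (y : Zd d)
    (hy : ∀ i, |y i| ≤ 3 * (L:ℤ)) : |u y - u 0| ≤ 12 * d * C1 d / K * u 0 := by
  have hd' : (1 : ℝ) ≤ d := by exact_mod_cast hd
  have hL' : (1 : ℝ) ≤ L := by exact_mod_cast hL
  have hC1 : 0 ≤ C1 d := Real.sqrt_nonneg _
  have hK0 : 18 * (d:ℝ) ≤ K := by nlinarith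
  have hKC : 6 * d * C1 d ≤ K := by nlinarith
  have hKpos : (0:ℝ) < K := by linarith
  have hKn : 1 ≤ K := by
    have : (0:ℝ) < K := hKpos
    exact_mod_cast this
  have hR : 1 ≤ K * L := Nat.mul_pos hKn hL
  set ε := C1 d / ((K * L : ℕ) : ℝ) with hε
  have ε0 : 0 ≤ ε := by positivity
  have hq : 2 * qq y ≤ ((K * L : ℕ):ℝ)^2 := by
    have h1 : qq y ≤ d * (9 * (L:ℝ)^2) := by
      have : ∀ i, (y i : ℝ) ^ 2 ≤ 9 * (L:ℝ)^2 := by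
        intro i
        have h := sq_le_sq.2 ((hy i).trans (le_abs_self _))
        have : (y i : ℝ)^2 ≤ (3 * (L:ℝ))^2 := by exact_mod_cast h
        linarith
      refine (Finset.sum_le_sum fun i _ => this i).trans (le_of_eq ?_)
      simp
    push_cast
    have : 18 * (d:ℝ) ≤ K ^ 2 := by nlinarith
    nlinarith [mul_le_mul_of_nonneg_right this (show (0:ℝ) ≤ (L:ℝ)^2 by positivity)]
  have hn : (l1 y : ℝ) ≤ 3 * d * L := by
    have : l1 y ≤ d * (3 * L) := by
      have : ∀ i ∈ Finset.univ, (y i).natAbs ≤ 3 * L := by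
        intro i _; have := hy i; rw [Int.abs_eq_natAbs] at this; omega
      have := Finset.sum_le_card_nsmul _ _ _ this
      simpa [l1] using this
    have h : (l1 y : ℝ) ≤ d * (3 * L) := by exact_mod_cast this
    linarith
  have hnε : (l1 y : ℝ) * ε ≤ 3 * d * C1 d / K := by
    calc (l1 y : ℝ) * ε ≤ 3 * d * L * ε := mul_le_mul_of_nonneg_right hn ε0
      _ = _ := by rw [hε]; push_cast; field_simp
  have hδ : 3 * d * C1 d / K ≤ 1 / 2 := by
    rw [div_le_iff₀ hKpos]; linarith
  have hε1 : ε ≤ 1 := by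
    rw [hε, div_le_one (by positivity)]
    push_cast
    nlinarith
  obtain ⟨c1, c2⟩ := chain hd hu (K * L) hR hh hε1 (l1 y) y hq rfl
  rw [← hε] at c1 c2
  have u0 := hu 0
  have su : ∀ x, √(u x) ^ 2 = u x := fun x => Real.sq_sqrt (hu x).le
  set n := l1 y
  have up : u y ≤ (1 + ε) ^ (2 * n) * u 0 := by
    have := pow_le_pow_left₀ (Real.sqrt_nonneg _) c1 2
    rw [mul_pow, su, su, ← pow_mul, mul_comm n 2] at this
    exact this
  have lo : (1 - ε) ^ (2 * n) * u 0 ≤ u y := by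
    have := pow_le_pow_left₀ (mul_nonneg (pow_nonneg (by linarith) _) (Real.sqrt_nonneg _)) c2 2
    rw [mul_pow, su, su, ← pow_mul, mul_comm n 2] at this
    exact this
  have e1 : (1 + ε) ^ (2 * n) ≤ 1 + 12 * d * C1 d / K := by
    set t := 2 * n * ε with ht
    have ht1 : t ≤ 6 * d * C1 d / K := by
      rw [show 6 * d * C1 d / K = 2 * (3 * d * C1 d / K) by ring]; nlinarith
    have ht0 : 0 ≤ t := by positivity
    have htt : t ≤ 1 := by nlinarith
    calc (1 + ε) ^ (2 * n) ≤ (Real.exp ε) ^ (2 * n) := 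
          pow_le_pow_left₀ (by linarith) (by linarith [Real.add_one_le_exp ε]) _
      _ = Real.exp t := by rw [← Real.exp_nat_mul]; push_cast; rfl
      _ ≤ 1 + 2 * t := by
          have := Real.abs_exp_sub_one_le (x := t) (by rw [abs_of_nonneg ht0]; exact htt)
          rw [abs_of_nonneg ht0] at this
          linarith [(abs_le.1 this).2]
      _ ≤ 1 + 2 * (6 * d * C1 d / K) := by linarith
      _ = _ := by ring
  have e2 : 1 - 12 * d * C1 d / K ≤ (1 - ε) ^ (2 * n) := by
    have := one_add_mul_le_pow (a := -ε) (by linarith) (2 * n)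
    push_cast at this
    have h2 : 12 * d * C1 d / K = 4 * (3 * d * C1 d / K) := by ring
    have : 0 ≤ 3 * d * C1 d / K := by positivity
    rw [show 1 - ε = 1 + -ε by ring]
    nlinarith
  rw [abs_le]
  constructor
  · nlinarith [mul_le_mul_of_nonneg_right e2 u0.le]
  · nlinarith [mul_le_mul_of_nonneg_right e1 u0.le]

lemma nb_add_const {d : ℕ} (u : Zd d → ℝ) (c : ℝ) (x : Zd d) :
    nb (fun y => u y + c) x = nb u x + 2 * d * c := by
  simp only [nb_eq]
  rw [Finset.sum_add_distrib, Finset.sum_const, nsmul_eq_mul]; simp [mul_comm]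

lemma grad_nonneg {d : ℕ} (hd : 0 < d) {u : Zd d → ℝ} (hu : ∀ x, 0 ≤ u x) (L K : ℕ) (hL : 1 ≤ L)
    (hK : 18 * (d:ℝ) + 6 * d * C1 d ≤ K)
    (hh : ∀ x : Zd d, (∀ i, |x i| ≤ ((K * L : ℕ):ℤ)) → nb u x = 2 * d * u x) (y : Zd d)
    (hy : ∀ i, |y i| ≤ 3 * (L:ℤ)) : |u y - u 0| ≤ 12 * d * C1 d / K * u 0 := by
  have hC1 : 0 ≤ C1 d := Real.sqrt_nonneg _
  set B := 12 * d * C1 d / K with hB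
  have B0 : 0 ≤ B := by positivity
  apply _root_.le_of_forall_pos_le_add
  intro ε hε
  have := grad_pos hd (u := fun y => u y + ε / (B + 1)) (fun x => by have := hu x; positivity) L K hL hK
    (fun x hx => by rw [nb_add_const, hh x hx]; ring) y hy
  rw [add_sub_add_right_eq_sub] at this
  refine this.trans ?_
  rw [← hB, mul_add]
  have : B * (ε / (B + 1)) ≤ ε := by
    rw [mul_div_assoc', div_le_iff₀ (by positivity)]; nlinarith
  linarith
end Disconnection

namespace Disconnection

lemma exp_Ioi (a : ℝ) (ha : 0 ≤ a) : expMeasure (Ioi a) = ENNReal.ofReal (Real.exp (-a)) := by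
  rw [expMeasure, withDensity_apply _ measurableSet_Ioi]
  have : ∫⁻ t in Ioi a, ENNReal.ofReal (if 0 < t then Real.exp (-t) else 0)
      = ∫⁻ t in Ioi a, ENNReal.ofReal (Real.exp (-t)) := by
    apply setLIntegral_congr_fun measurableSet_Ioi
    intro t ht
    have : 0 < t := lt_of_le_of_lt ha ht
    simp [this]
  rw [this, ← integral_exp_neg_Ioi a, ofReal_integral_eq_lintegral_ofReal]
  · exact integrableOn_exp_neg_Ioi a
  · exact Filter.Eventually.of_forall fun t => (Real.exp_pos _).le

lemma exp_Iic0 : expMeasure (Iic 0) = 0 := by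
  rw [expMeasure, withDensity_apply _ measurableSet_Iic]
  have : ∫⁻ t in Iic (0:ℝ), ENNReal.ofReal (if 0 < t then Real.exp (-t) else 0)
      = ∫⁻ t in Iic (0:ℝ), 0 := by
    apply setLIntegral_congr_fun measurableSet_Iic
    intro t ht
    have : ¬ 0 < t := not_lt.2 ht
    simp [this]
  rw [this]; simp

lemma exp_univ : expMeasure univ = 1 := by
  rw [← Iic_union_Ioi (a := (0:ℝ)), measure_union (Iic_disjoint_Ioi le_rfl) measurableSet_Ioi,
    exp_Iic0, exp_Ioi 0 le_rfl]
  simp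

lemma exp_Iic1 : expMeasure (Iic 1) < 1 := by
  have h : expMeasure (Iic 1) + expMeasure (Ioi 1) = 1 := by
    rw [← measure_union (Iic_disjoint_Ioi le_rfl) measurableSet_Ioi, Iic_union_Ioi, exp_univ]
  have h1 : expMeasure (Iic 1) ≠ ⊤ := by
    intro h'
    rw [h'] at h; simp at h
  rw [← h]
  apply ENNReal.lt_add_right h1
  rw [exp_Ioi 1 (by norm_num)]
  simp [Real.exp_pos]

section
variable {d : ℕ} {Ω : Type*} [MeasurableSpace Ω] (W : SRW d Ω)

/-- increments -/
def inc (W : SRW d Ω) (n : ℕ) (ω : Ω) : Fin n → Zd d :=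
  fun i => W.Y ((i : ℕ) + 1) ω - W.Y (i : ℕ) ω

lemma meas_inc (n : ℕ) : Measurable (inc W n) := by
  apply measurable_pi_lambda
  intro i
  exact (W.measurable_Y _).sub (W.measurable_Y _)

lemma law_inc (x : Zd d) (n : ℕ) (s : Fin n → Zd d) :
    W.P x (inc W n ⁻¹' {s}) = ∏ i, stepP d (s i) := by
  have := W.law x n s (fun _ => univ) (fun _ => MeasurableSet.univ)
  simp only [exp_univ, Finset.prod_const_one, mul_one] at this
  rw [← this]
  congr 1
  ext ω
  simp [inc, funext_iff]

lemma law_set (x : Zd d) (n : ℕ) (S : Set (Fin n → Zd d)) :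
    W.P x (inc W n ⁻¹' S) = ∑' s, S.indicator (fun s => ∏ i, stepP d (s i)) s := by
  have hS : MeasurableSet S := S.to_countable.measurableSet
  rw [← Measure.map_apply (meas_inc W n) hS, ← Measure.tsum_indicator_apply_singleton _ _ hS]
  refine tsum_congr fun s => ?_
  by_cases h : s ∈ S
  · rw [indicator_of_mem h, indicator_of_mem h, 
      Measure.map_apply (meas_inc W n) (measurableSet_singleton s), law_inc]
  · rw [indicator_of_notMem h, indicator_of_notMem h]

lemma law_zeta (x : Zd d) (n : ℕ) (I : Fin n → Set ℝ) (hI : ∀ i, MeasurableSet (I i)) :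
    W.P x {ω | ∀ i : Fin n, W.ζ i ω ∈ I i} = ∏ i, expMeasure (I i) := by
  haveI := W.isProb x
  set B := {ω | ∀ i : Fin n, W.ζ i ω ∈ I i} with hB
  have hBm : MeasurableSet B := by
    rw [hB, show {ω | ∀ i : Fin n, W.ζ i ω ∈ I i} = ⋂ i : Fin n, W.ζ i ⁻¹' I i by ext; simp]
    exact MeasurableSet.iInter fun i => W.measurable_ζ _ (hI i)
  have hm : ∀ y ∈ (univ : Set (Fin n → Zd d)), MeasurableSet (inc W n ⁻¹' {y}) :=
    fun y _ => meas_inc W n (measurableSet_singleton y)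
  have h1 := tsum_measure_preimage_singleton (μ := W.P x) (countable_univ) hm
  have h2 := tsum_measure_preimage_singleton (μ := (W.P x).restrict B) (countable_univ) hm
  rw [preimage_univ, measure_univ] at h1
  rw [preimage_univ, Measure.restrict_apply_univ] at h2
  rw [← h2]
  have h3 : ∀ b : (univ : Set (Fin n → Zd d)), (W.P x).restrict B (inc W n ⁻¹' {b.1})
      = W.P x (inc W n ⁻¹' {b.1}) * ∏ i, expMeasure (I i) := by
    intro b
    rw [Measure.restrict_apply (hm b.1 (mem_univ _)), law_inc, ← W.law x n b.1 I hI]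
    congr 1
    ext ω
    simp [inc, funext_iff, hB]
  rw [tsum_congr h3, ENNReal.tsum_mul_right, h1, one_mul]

/-- admissible increments -/
def okp (V T : Set (Zd d)) : (m : ℕ) → Zd d → (Fin m → Zd d) → Prop
  | 0, x, _ => x ∈ T
  | m + 1, x, s => x ∈ V ∧ okp V T m (x + s 0) (Fin.tail s)

lemma okp_iff (V T : Set (Zd d)) (m : ℕ) : ∀ y : ℕ → Zd d,
    okp V T m (y 0) (fun i => y ((i:ℕ) + 1) - y i) ↔ y m ∈ T ∧ ∀ k < m, y k ∈ V := by
  induction m with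
  | zero => intro y; simp [okp]
  | succ m ih =>
    intro y
    have := ih (fun k => y (k + 1))
    simp only [okp]
    have e : y 0 + (y (((0 : Fin (m+1)) : ℕ) + 1) - y ((0 : Fin (m+1)) : ℕ)) = y 1 := by simp
    have e2 : Fin.tail (fun i : Fin (m+1) => y ((i:ℕ) + 1) - y i)
      = fun i : Fin m => y ((i:ℕ) + 1 + 1) - y ((i:ℕ) + 1) := by
      funext i; simp [Fin.tail]
    rw [e, e2, this]
    constructor
    · rintro ⟨h0, h1, h2⟩
      refine ⟨h1, fun k hk => ?_⟩
      rcases k with _ | k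
      · exact h0
      · exact h2 k (by omega)
    · rintro ⟨h1, h2⟩
      exact ⟨h2 0 (by omega), h1, fun k hk => h2 (k+1) (by omega)⟩

noncomputable def am (V T : Set (Zd d)) (m : ℕ) (x : Zd d) : ℝ≥0∞ :=
  ∑' s : Fin m → Zd d, {s | okp V T m x s}.indicator (fun s => ∏ i, stepP d (s i)) s

lemma am_zero (V T : Set (Zd d)) (x : Zd d) : am V T 0 x = if x ∈ T then 1 else 0 := by
  rw [am, tsum_fintype]
  simp [okp, indicator]

lemma vv_inj : Function.Injective (vv : Fin d × Bool → Zd d) := by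
  rintro ⟨i, b⟩ ⟨j, c⟩ h
  have h1 := congrFun h i
  have h2 := congrFun h j
  by_cases hij : i = j
  · subst hij
    cases b <;> cases c <;> simp [vv, ee] at h1 ⊢ <;> omega
  · have hji : ¬ j = i := fun h => hij h.symm
    exfalso
    cases b <;> cases c <;> simp [vv, ee, hij, hji] at h1

lemma stepP_vv (e : Fin d × Bool) : stepP d (vv e) = ((2 * d : ℕ) : ℝ≥0∞)⁻¹ := by
  rw [stepP, if_pos]
  rcases e with ⟨i, b⟩
  have : ∀ j, (vv (i, b) j).natAbs = if j = i then 1 else 0 := by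
    intro j
    cases b <;> simp [vv, ee] <;> split_ifs <;> simp
  rw [Finset.sum_congr rfl fun j _ => this j]
  simp

lemma stepP_tsum (F : Zd d → ℝ≥0∞) : 
    ∑' v, stepP d v * F v = ((2 * d : ℕ) : ℝ≥0∞)⁻¹ * ∑ e, F (vv e) := by
  rw [← vv_inj.tsum_eq, tsum_fintype, Finset.mul_sum]
  · exact Finset.sum_congr rfl fun e _ => by rw [stepP_vv]
  · intro v hv
    have h1 : l1 v = 0 + 1 := by
      by_contra h
      apply hv
      simp only [l1] at h
      simp [stepP, h]
    obtain ⟨y', e, rfl, h, _⟩ := exists_pred v 0 h1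
    have : y' = 0 := by
      funext i
      have := (Finset.sum_eq_zero_iff.1 h) i (Finset.mem_univ i)
      simpa using this
    exact ⟨e, by simp [this]⟩

lemma am_succ (V T : Set (Zd d)) (m : ℕ) (x : Zd d) : am V T (m + 1) x =
    if x ∈ V then ((2 * d : ℕ) : ℝ≥0∞)⁻¹ * ∑ e, am V T m (x + vv e) else 0 := by
  split_ifs with h
  · rw [← stepP_tsum (fun v => am V T m (x + v)), am,
      ← (Fin.consEquiv (fun _ : Fin (m+1) => Zd d)).tsum_eq, ENNReal.tsum_prod']
    refine tsum_congr fun v => ?_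
    rw [am, ← ENNReal.tsum_mul_left]
    refine tsum_congr fun s => ?_
    simp only [Fin.consEquiv, Equiv.coe_fn_mk, indicator, mem_ofPred_eq, okp, Fin.cons_zero, Fin.tail_cons, h, true_and,
      Fin.prod_univ_succ, Fin.cons_succ]
    split_ifs <;> simp
  · rw [am]
    simp [okp, h, indicator]

/-- reach T through V -/
def Reach (W : SRW d Ω) (V T : Set (Zd d)) : Set Ω := {ω | ∃ m, W.Y m ω ∈ T ∧ ∀ k < m, W.Y k ω ∈ V}

lemma Y0_ae (x : Zd d) : ∀ᵐ ω ∂ W.P x, W.Y 0 ω = x := by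
  haveI := W.isProb x
  exact (prob_compl_eq_zero_iff (W.measurable_Y 0 (measurableSet_singleton x))).2 (W.Y_zero x)

lemma P_reach (V T : Set (Zd d)) (hVT : Disjoint V T) (x : Zd d) :
    W.P x (Reach W V T) = ∑' m, am V T m x := by
  have hm : ∀ (n : ℕ) (A : Set (Zd d)), MeasurableSet {ω | W.Y n ω ∈ A} :=
    fun n A => W.measurable_Y n A.to_countable.measurableSet
  have hE : Reach W V T = ⋃ m, {ω | W.Y m ω ∈ T ∧ ∀ k < m, W.Y k ω ∈ V} := by
    ext ω; simp [Reach]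
  rw [hE, measure_iUnion]
  · refine tsum_congr fun m => ?_
    rw [am, ← law_set W x]
    apply measure_congr
    filter_upwards [Y0_ae W x] with ω hω
    have := okp_iff V T m (fun k => W.Y k ω)
    rw [hω] at this
    exact propext this.symm
  · intro m n hmn
    apply Set.disjoint_left.2
    rintro ω ⟨h1, h2⟩ ⟨h3, h4⟩
    rcases lt_or_gt_of_ne hmn with h | h
    · exact Set.disjoint_left.1 hVT (h4 m h) h1
    · exact Set.disjoint_left.1 hVT (h2 n h) h3
  · intro m
    have : {ω | W.Y m ω ∈ T ∧ ∀ k < m, W.Y k ω ∈ V} 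
      = {ω | W.Y m ω ∈ T} ∩ ⋂ k, ⋂ (_ : k < m), {ω | W.Y k ω ∈ V} := by
      ext ω; simp
    rw [this]
    exact (hm m T).inter (MeasurableSet.iInter fun k => MeasurableSet.iInter fun _ => hm k V)

lemma P_reach_eq (V T : Set (Zd d)) (hVT : Disjoint V T) (x : Zd d) :
    W.P x (Reach W V T) = (if x ∈ T then 1 else 0) + 
      if x ∈ V then ((2 * d : ℕ) : ℝ≥0∞)⁻¹ * ∑ e, W.P (x + vv e) (Reach W V T) else 0 := by
  rw [P_reach W V T hVT, tsum_eq_zero_add' ENNReal.summable, am_zero]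
  congr 1
  simp_rw [am_succ, P_reach W V T hVT]
  split_ifs
  · rw [ENNReal.tsum_mul_left, Summable.tsum_finsetSum fun _ _ => ENNReal.summable]
  · simp

noncomputable def rr (W : SRW d Ω) (V T : Set (Zd d)) (x : Zd d) : ℝ := (W.P x (Reach W V T)).toReal

lemma rr_nonneg (V T : Set (Zd d)) (x : Zd d) : 0 ≤ rr W V T x := ENNReal.toReal_nonneg

lemma rr_T (V T : Set (Zd d)) (hVT : Disjoint V T) (x : Zd d) (hx : x ∈ T) : rr W V T x = 1 := by
  rw [rr, P_reach_eq W V T hVT, if_pos hx, if_neg (fun h => Set.disjoint_left.1 hVT h hx)]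
  simp

lemma rr_out (V T : Set (Zd d)) (hVT : Disjoint V T) (x : Zd d) (hx : x ∉ T) (hx' : x ∉ V) :
    rr W V T x = 0 := by
  rw [rr, P_reach_eq W V T hVT, if_neg hx, if_neg hx']
  simp

lemma rr_harm (hd : 0 < d) (V T : Set (Zd d)) (hVT : Disjoint V T) (x : Zd d) (hx : x ∈ V) :
    nb (rr W V T) x = 2 * d * rr W V T x := by
  have hd' : (0:ℝ) < d := by exact_mod_cast hd
  have : rr W V T x = (2 * d : ℝ)⁻¹ * nb (rr W V T) x := by
    rw [rr, P_reach_eq W V T hVT, if_neg (Set.disjoint_left.1 hVT hx), if_pos hx, nb_eq, zero_add,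
      ENNReal.toReal_mul, ENNReal.toReal_sum]
    · simp [rr]
    · intro e _
      haveI := W.isProb (x + vv e)
      exact measure_ne_top _ _
  rw [this]; field_simp

lemma rr_min (hd : 0 < d) (V T : Set (Zd d)) (hVT : Disjoint V T) (G : Zd d → ℝ) (hG : ∀ x, 0 ≤ G x)
    (hs : ∀ x, nb G x ≤ 2 * d * G x) (hT : ∀ x ∈ T, 1 ≤ G x) (x : Zd d) : rr W V T x ≤ G x := by
  have hd' : (0:ℝ) < d := by exact_mod_cast hd
  have key : ∀ n x, ∑ m ∈ Finset.range n, am V T m x ≤ ENNReal.ofReal (G x) := by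
    intro n
    induction n with
    | zero => intro x; simp
    | succ n ih =>
      intro x
      rw [Finset.sum_range_succ', am_zero]
      simp_rw [am_succ]
      by_cases hV : x ∈ V
      · simp only [hV, if_true, if_neg (Set.disjoint_left.1 hVT hV), add_zero]
        rw [← Finset.mul_sum, Finset.sum_comm]
        calc _ ≤ ((2 * d : ℕ) : ℝ≥0∞)⁻¹ * ∑ e : Fin d × Bool, ENNReal.ofReal (G (x + vv e)) := by
              gcongr with e; exact ih _
          _ = ENNReal.ofReal ((2 * d : ℝ)⁻¹ * nb G x) := by
              rw [nb_eq, ENNReal.ofReal_mul (by positivity), ENNReal.ofReal_sum_of_nonneg fun e _ => hG _,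
                ENNReal.ofReal_inv_of_pos (by positivity)]
              congr 2
              rw [show (2 * d : ℝ) = ((2 * d : ℕ) : ℝ) by push_cast; ring, ENNReal.ofReal_natCast]
          _ ≤ _ := by
              apply ENNReal.ofReal_le_ofReal
              rw [inv_mul_le_iff₀ (by positivity)]
              exact hs x
      · simp only [hV, if_false, Finset.sum_const_zero, zero_add]
        split_ifs with h
        · rw [← ENNReal.ofReal_one]; exact ENNReal.ofReal_le_ofReal (hT x h)
        · simp
  rw [rr, P_reach W V T hVT]
  apply ENNReal.toReal_le_of_le_ofReal (hG x)
  exact ENNReal.tsum_le_of_sum_range_le fun n => key n x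

end

lemma max_princ {d : ℕ} (hd : 0 < d) (V : Set (Zd d)) (hV : V.Finite) (f : Zd d → ℝ)
    (h1 : ∀ x ∈ V, 2 * d * f x ≤ nb f x) (h2 : ∀ x ∉ V, f x ≤ 0) (x : Zd d) : f x ≤ 0 := by
  have hd' : (0:ℝ) < d := by exact_mod_cast hd
  by_contra hx
  push Not at hx
  have hxV : x ∈ V := by by_contra h; linarith [h2 x h]
  obtain ⟨y, hy, hmax⟩ := Set.exists_max_image V f hV ⟨x, hxV⟩
  have hpos : 0 < f y := hx.trans_le (hmax x hxV)
  have hall : ∀ z, f z ≤ f y := by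
    intro z
    by_cases hz : z ∈ V
    · exact hmax z hz
    · linarith [h2 z hz]
  obtain ⟨w, ⟨hw, hwy⟩, hwm⟩ := Set.exists_max_image {w | w ∈ V ∧ f w = f y} (fun w => w ⟨0, hd⟩)
    (hV.subset fun w hw => hw.1) ⟨y, hy, rfl⟩
  have hn := h1 w hw
  rw [nb_eq, hwy] at hn
  have hle : f y ≤ f (w + vv (⟨0, hd⟩, true)) := by
    by_contra hlt
    push Not at hlt
    have : ∑ e : Fin d × Bool, f (w + vv e) < ∑ e : Fin d × Bool, f y :=
      Finset.sum_lt_sum (fun e _ => hall _) ⟨(⟨0, hd⟩, true), Finset.mem_univ _, hlt⟩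
    simp at this
    linarith
  have heq := le_antisymm (hall _) hle
  have hin : w + vv (⟨0, hd⟩, true) ∈ V := by
    by_contra h
    linarith [h2 _ h]
  have := hwm _ ⟨hin, heq⟩
  simp [vv, ee] at this

section
variable {d : ℕ} {Ω : Type*} [MeasurableSpace Ω] (W : SRW d Ω)

/-- good trajectories -/
def Good (W : SRW d Ω) (ω : Ω) : Prop := (∀ i, 0 < W.ζ i ω) ∧ ∀ t : ℝ, ∃ n, t < W.S n ω

lemma good_ae (x : Zd d) : ∀ᵐ ω ∂ W.P x, Good W ω := by
  haveI := W.isProb x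
  have h1 : ∀ᵐ ω ∂ W.P x, ∀ i, 0 < W.ζ i ω := by
    rw [ae_all_iff]
    intro i
    have := law_zeta W x (i + 1) (fun j => if (j : ℕ) = i then Iic 0 else univ)
      (fun j => by split_ifs; exacts [measurableSet_Iic, MeasurableSet.univ])
    have hz : ∏ j : Fin (i + 1), expMeasure (if (j : ℕ) = i then Iic 0 else univ) = 0 :=
      Finset.prod_eq_zero (Finset.mem_univ (Fin.last i)) (by simp [exp_Iic0])
    rw [hz] at this
    refine measure_mono_null ?_ this
    intro ω hω j
    have hω' : ¬ 0 < W.ζ i ω := hω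
    split_ifs with h
    · rw [h]; exact not_lt.1 hω'
    · trivial
  have h2 : ∀ᵐ ω ∂ W.P x, ∀ n, ∃ i, n ≤ i ∧ 1 < W.ζ i ω := by
    rw [ae_all_iff]
    intro n
    have hb : ∀ m : ℕ, W.P x {ω | ¬ ∃ i, n ≤ i ∧ 1 < W.ζ i ω} ≤ (expMeasure (Iic 1)) ^ m := by
      intro m
      have := law_zeta W x (n + m) (fun j => if n ≤ (j : ℕ) then Iic 1 else univ)
        (fun j => by split_ifs; exacts [measurableSet_Iic, MeasurableSet.univ])
      have hz : ∏ j : Fin (n + m), expMeasure (if n ≤ (j : ℕ) then Iic 1 else univ) 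
          = (expMeasure (Iic 1)) ^ m := by
        rw [Fin.prod_univ_add]
        have a : ∀ j : Fin n, expMeasure (if n ≤ ((Fin.castAdd m j : Fin (n+m)) : ℕ) then Iic 1 else univ) = 1 := by
          intro j
          have := j.2
          rw [if_neg (by simp), exp_univ]
        have b : ∀ j : Fin m, expMeasure (if n ≤ ((Fin.natAdd n j : Fin (n+m)) : ℕ) then Iic 1 else univ) 
            = expMeasure (Iic 1) := by
          intro j
          rw [if_pos (by simp)]
        rw [Finset.prod_congr rfl fun j _ => a j, Finset.prod_congr rfl fun j _ => b j]
        simp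
      rw [hz] at this
      rw [← this]
      apply measure_mono
      intro ω hω j
      have hω' : ¬ ∃ i, n ≤ i ∧ 1 < W.ζ i ω := hω
      push Not at hω'
      split_ifs with h
      · exact hω' j h
      · trivial
    have ht := ENNReal.tendsto_pow_atTop_nhds_zero_of_lt_one exp_Iic1
    exact le_antisymm (ge_of_tendsto' ht hb) zero_le
  filter_upwards [h1, h2] with ω hω1 hω2
  refine ⟨hω1, ?_⟩
  have mono : ∀ m n, m ≤ n → W.S m ω ≤ W.S n ω := by
    intro m n hmn
    exact Finset.sum_le_sum_of_subset_of_nonneg (Finset.range_mono hmn) fun i _ _ => (hω1 i).le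
  have key : ∀ N : ℕ, ∃ n, (N : ℝ) ≤ W.S n ω := by
    intro N
    induction N with
    | zero => exact ⟨0, by simp [SRW.S]⟩
    | succ N ih =>
      obtain ⟨n, hn⟩ := ih
      obtain ⟨i, hi, h1⟩ := hω2 n
      refine ⟨i + 1, ?_⟩
      have : W.S (i + 1) ω = W.S i ω + W.ζ i ω := Finset.sum_range_succ _ _
      have := mono n i hi
      push_cast; linarith
  intro t
  obtain ⟨N, hN⟩ := exists_nat_gt t
  obtain ⟨n, hn⟩ := key N
  exact ⟨n, hN.trans_le hn⟩

variable {W} {ω : Ω} (hg : Good W ω)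
include hg

lemma S_strict : StrictMono (fun n => W.S n ω) := by
  apply strictMono_nat_of_lt_succ
  intro n
  have : W.S (n + 1) ω = W.S n ω + W.ζ n ω := Finset.sum_range_succ _ _
  have := hg.1 n
  linarith

lemma S_nonneg (n : ℕ) : 0 ≤ W.S n ω := by
  have := (S_strict hg).monotone (Nat.zero_le n)
  simpa [SRW.S] using this

lemma jump_bdd (t : ℝ) : BddAbove {k : ℕ | W.S k ω ≤ t} := by
  obtain ⟨n, hn⟩ := hg.2 t
  refine ⟨n, fun k hk => ?_⟩
  by_contra h
  push Not at h
  have h1 := S_strict hg h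
  have h2 : W.S k ω ≤ t := hk
  simp only at h1
  linarith

lemma jump_S (n : ℕ) : W.jumpIdx (W.S n ω) ω = n := by
  have : {k : ℕ | W.S k ω ≤ W.S n ω} = Iic n := by
    ext k
    exact (S_strict hg).le_iff_le
  rw [SRW.jumpIdx, this, csSup_Iic]

lemma S_jump_le (t : ℝ) (ht : 0 ≤ t) : W.S (W.jumpIdx t ω) ω ≤ t := by
  have : W.jumpIdx t ω ∈ {k : ℕ | W.S k ω ≤ t} :=
    Nat.sSup_mem ⟨0, by simp [SRW.S, ht]⟩ (jump_bdd hg t)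
  exact this

lemma hit_top (A : Set (Zd d)) (h : ∀ n, W.Y n ω ∉ A) : W.hit A ω = ⊤ := by
  rw [SRW.hit, SRW.hitFrom, sInf_eq_top]
  rintro u ⟨s, rfl, _, hs⟩
  exact absurd hs (h _)

lemma hit_eq (A : Set (Zd d)) (m : ℕ) (hm : W.Y m ω ∈ A) (h : ∀ k < m, W.Y k ω ∉ A) :
    W.hit A ω = ENNReal.ofReal (W.S m ω) := by
  rw [SRW.hit, SRW.hitFrom]
  apply le_antisymm
  · apply sInf_le
    refine ⟨(W.S m ω).toNNReal, rfl, zero_le, ?_⟩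
    rw [Real.coe_toNNReal _ (S_nonneg hg m), SRW.X, jump_S hg]
    exact hm
  · apply le_sInf
    rintro u ⟨s, rfl, _, hs⟩
    have h1 : m ≤ W.jumpIdx s ω := by
      by_contra hlt
      push Not at hlt
      exact h _ hlt hs
    have h2 := (S_strict hg).monotone h1
    have h3 := S_jump_le hg s s.2
    rw [ENNReal.ofReal_le_iff_le_toReal (by simp)]
    simp; linarith

lemma hit_top_iff (A : Set (Zd d)) : W.hit A ω = ⊤ ↔ ω ∉ Reach W Aᶜ A := by
  constructor
  · rintro h ⟨m, hm, hk⟩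
    rw [hit_eq hg A m hm hk] at h
    simp at h
  · intro h
    apply hit_top hg
    intro n hn
    classical
    have hex : ∃ n, W.Y n ω ∈ A := ⟨n, hn⟩
    exact h ⟨Nat.find hex, Nat.find_spec hex, fun k hk => Nat.find_min hex hk⟩

lemma reach_or (U : Set (Zd d)) : ω ∈ Reach W U Uᶜ ∨ ∀ n, W.Y n ω ∈ U := by
  by_cases h : ∀ n, W.Y n ω ∈ U
  · exact Or.inr h
  · push Not at h
    exact Or.inl ⟨Nat.find h, Nat.find_spec h, fun k hk => by
      have := Nat.find_min h hk
      push Not at this; exact this⟩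

lemma exit_lt_iff (A U : Set (Zd d)) (hAU : A ⊆ U) :
    W.exit U ω < W.hit A ω ↔ ω ∈ Reach W (U \ A) Uᶜ := by
  rcases reach_or hg U with ⟨m, hm, hk⟩ | h
  · have he : W.exit U ω = ENNReal.ofReal (W.S m ω) :=
      hit_eq hg Uᶜ m hm (fun k hk' => by simpa using hk k hk')
    rw [he]
    constructor
    · intro hlt
      refine ⟨m, hm, fun k hkm => ⟨hk k hkm, fun hA => ?_⟩⟩
      have hex : ∃ n, W.Y n ω ∈ A := ⟨k, hA⟩
      rw [hit_eq hg A (Nat.find hex) (Nat.find_spec hex) (fun k hk => Nat.find_min hex hk)] at hlt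
      have h1 : Nat.find hex ≤ m := (Nat.find_min' hex hA).trans hkm.le
      have h2 := (S_strict hg).monotone h1
      exact absurd hlt (not_lt.2 (ENNReal.ofReal_le_ofReal h2))
    · rintro ⟨n, hn, hk2⟩
      have hmn : m = n := by
        rcases lt_trichotomy m n with h | h | h
        · exact absurd (hk2 m h).1 hm
        · exact h
        · exact absurd (hk n h) hn
      subst hmn
      by_cases hex : ∃ n, W.Y n ω ∈ A
      · rw [hit_eq hg A (Nat.find hex) (Nat.find_spec hex) (fun k hk => Nat.find_min hex hk)]
        have h1 : m < Nat.find hex := by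
          rcases lt_trichotomy m (Nat.find hex) with h | h | h
          · exact h
          · exact absurd (hAU (Nat.find_spec hex)) (h ▸ hm)
          · exact absurd (Nat.find_spec hex) (hk2 _ h).2
        have h2 := S_strict hg h1
        simp only at h2
        exact (ENNReal.ofReal_lt_ofReal_iff_of_nonneg (S_nonneg hg m)).2 h2
      · push Not at hex
        rw [hit_top hg A hex]
        exact ENNReal.ofReal_lt_top
  · have he : W.exit U ω = ⊤ := hit_top hg Uᶜ (fun n => by simpa using h n)
    rw [he]
    constructor
    · intro h; simp at h
    · rintro ⟨n, hn, _⟩; exact absurd (h n) hn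

lemma xat_iff (U : Set (Zd d)) (z : Zd d) (hz : z ∉ U) (hr : ω ∈ Reach W U Uᶜ) :
    W.Xat (W.exit U) ω = z ↔ ω ∈ Reach W U {z} := by
  obtain ⟨m, hm, hk⟩ := hr
  have he : W.exit U ω = ENNReal.ofReal (W.S m ω) :=
    hit_eq hg Uᶜ m hm (fun k hk' => by simpa using hk k hk')
  rw [SRW.Xat, he, ENNReal.toReal_ofReal (S_nonneg hg m), SRW.X, jump_S hg]
  constructor
  · intro h; exact ⟨m, h, hk⟩
  · rintro ⟨n, hn, hk2⟩
    have hn' : W.Y n ω = z := hn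
    rcases lt_trichotomy m n with h | h | h
    · exact absurd (hk2 m h) hm
    · rw [h]; exact hn'
    · exact absurd (hk n h) (hn' ▸ hz)

lemma exit_xat_iff (A U : Set (Zd d)) (hAU : A ⊆ U) (z : Zd d) (hz : z ∉ U) :
    (W.exit U ω < W.hit A ω ∧ W.Xat (W.exit U) ω = z) ↔ ω ∈ Reach W (U \ A) {z} := by
  rw [exit_lt_iff hg A U hAU]
  constructor
  · rintro ⟨⟨m, hm, hk⟩, h⟩
    rw [xat_iff hg U z hz ⟨m, hm, fun k hkm => (hk k hkm).1⟩] at h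
    obtain ⟨n, hn, hk2⟩ := h
    have hn' : W.Y n ω = z := hn
    rcases lt_trichotomy m n with h | h | h
    · exact absurd (hk2 m h) hm
    · subst h; exact ⟨m, hn, hk⟩
    · exact absurd (hk n h).1 (hn' ▸ hz)
  · rintro ⟨n, hn, hk⟩
    have hn' : W.Y n ω = z := hn
    have hU : W.Y n ω ∈ Uᶜ := by rw [hn']; exact hz
    refine ⟨⟨n, hU, hk⟩, ?_⟩
    rw [xat_iff hg U z hz ⟨n, hU, fun k hkm => (hk k hkm).1⟩]
    exact ⟨n, hn, fun k hkm => (hk k hkm).1⟩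
end
end Disconnection

namespace Disconnection

lemma mem_ball0 {d : ℕ} (y : Zd d) (r : ℕ) : y ∈ ball (0 : Zd d) r ↔ ∀ i, |y i| ≤ (r : ℤ) := by
  show supDist 0 y ≤ r ↔ _
  rw [supDist, Finset.sup_le_iff]
  constructor
  · intro h i
    have := h i (Finset.mem_univ i)
    simp at this
    rw [abs_le]; omega
  · intro h i _
    have := h i
    simp
    rw [abs_le] at this; omega

lemma bdry_ball {d : ℕ} (x : Zd d) (r : ℕ) (hx : x ∈ bdry (ball (0 : Zd d) r)) :
    (∀ i, |x i| ≤ (r : ℤ) + 1) ∧ ∃ j : Fin d, ∃ σ : ℤ, σ ^ 2 = 1 ∧ (r : ℤ) + 1 ≤ σ * x j := by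
  obtain ⟨h1, y, hy, hadj⟩ := hx
  rw [mem_ball0] at h1 hy
  constructor
  · intro i
    have h2 : (y i - x i).natAbs ≤ 1 := by
      have := Finset.single_le_sum (f := fun i => (y i - x i).natAbs) (fun _ _ => Nat.zero_le _)
        (Finset.mem_univ i)
      rw [adjacent] at hadj
      rw [hadj] at this
      exact this
    have := hy i
    rw [abs_le] at *
    omega
  · push Not at h1
    obtain ⟨j, hj⟩ := h1
    rcases abs_cases (x j) with ⟨h, _⟩ | ⟨h, _⟩
    · exact ⟨j, 1, by norm_num, by omega⟩
    · exact ⟨j, -1, by norm_num, by omega⟩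

lemma nb_lin {d : ℕ} (a b c e : ℝ) (f g k : Zd d → ℝ) (x : Zd d) :
    nb (fun y => a * f y + b * g y + c * k y + e) x = a * nb f x + b * nb g x + c * nb k x + 2 * d * e := by
  simp only [nb_eq, Finset.sum_add_distrib, Finset.mul_sum]
  rw [Finset.sum_const, Finset.card_univ]
  simp only [Fintype.card_prod, Fintype.card_fin, Fintype.card_bool, nsmul_eq_mul]
  push_cast
  ring

section
variable {d : ℕ} {Ω : Type*} [MeasurableSpace Ω] (W : SRW d Ω)

lemma meas_reach (V T : Set (Zd d)) : MeasurableSet (Reach W V T) := by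
  have hm : ∀ (n : ℕ) (A : Set (Zd d)), MeasurableSet {ω | W.Y n ω ∈ A} :=
    fun n A => W.measurable_Y n A.to_countable.measurableSet
  have hE : Reach W V T = ⋃ m, ({ω | W.Y m ω ∈ T} ∩ ⋂ k, ⋂ (_ : k < m), {ω | W.Y k ω ∈ V}) := by
    ext ω; simp [Reach]
  rw [hE]
  exact MeasurableSet.iUnion fun m =>
    (hm m T).inter (MeasurableSet.iInter fun k => MeasurableSet.iInter fun _ => hm k V)

lemma rr_le_one (V T : Set (Zd d)) (x : Zd d) : rr W V T x ≤ 1 := by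
  have := W.isProb x
  exact ENNReal.toReal_le_of_le_ofReal zero_le_one (by simpa using prob_le_one)

lemma exit_one (hd : 0 < d) (U : Set (Zd d)) (hU : U.Finite) (x : Zd d) : rr W U Uᶜ x = 1 := by
  have hdis : Disjoint U Uᶜ := disjoint_compl_right
  have h := max_princ hd U hU (fun y => (-1) * rr W U Uᶜ y + 0 * rr W U Uᶜ y + 0 * rr W U Uᶜ y + 1)
    (fun y hy => by
      rw [nb_lin, rr_harm W hd U Uᶜ hdis y hy]
      apply le_of_eq; ring)
    (fun y hy => by
      rw [rr_T W U Uᶜ hdis y hy]; norm_num) x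
  have := rr_le_one W U Uᶜ x
  linarith

lemma exit_ae (hd : 0 < d) (U : Set (Zd d)) (hU : U.Finite) (x : Zd d) :
    ∀ᵐ ω ∂ W.P x, ω ∈ Reach W U Uᶜ := by
  have := W.isProb x
  have h := exit_one W hd U hU x
  apply (prob_compl_eq_zero_iff (meas_reach W U Uᶜ)).2
  rw [rr] at h
  rw [← ENNReal.ofReal_toReal (measure_ne_top (W.P x) (Reach W U Uᶜ)), h, ENNReal.ofReal_one]

lemma main_est (hd : 0 < d) (A U : Set (Zd d)) (hU : U.Finite) (hAU : A ⊆ U) (z : Zd d) (hz : z ∉ U)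
    (δ : ℝ) (hA : ∀ y ∈ A, |rr W U {z} y - rr W U {z} 0| ≤ δ * rr W U {z} 0) (x : Zd d)
    (hx : |rr W U {z} x - rr W U {z} 0| ≤ δ * rr W U {z} 0) :
    |rr W (U \ A) {z} x - rr W U {z} 0 * rr W (U \ A) Uᶜ x| ≤ 2 * δ * rr W U {z} 0 := by
  have d1 : Disjoint U {z} := by simpa using hz
  have d2 : Disjoint (U \ A) {z} := d1.mono_left sdiff_subset
  have d3 : Disjoint (U \ A) Uᶜ := (disjoint_compl_right).mono_left sdiff_subset
  set h := rr W U {z} with hh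
  set w := rr W (U \ A) {z} with hw
  set p := rr W (U \ A) Uᶜ with hp
  have hV : (U \ A).Finite := hU.subset sdiff_subset
  have H : ∀ y ∈ U \ A, nb h y = 2 * d * h y ∧ nb w y = 2 * d * w y ∧ nb p y = 2 * d * p y :=
    fun y hy => ⟨rr_harm W hd _ _ d1 y hy.1, rr_harm W hd _ _ d2 y hy, rr_harm W hd _ _ d3 y hy⟩
  have B : ∀ y ∉ U \ A, (h y = w y ∧ p y = 1) ∨ (w y = 0 ∧ p y = 0 ∧ |h y - h 0| ≤ δ * h 0) := by
    intro y hy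
    by_cases hyU : y ∈ U
    · have hyA : y ∈ A := by by_contra h'; exact hy ⟨hyU, h'⟩
      right
      have hyz : y ∉ ({z} : Set (Zd d)) := fun h' => hz (by rw [← mem_singleton_iff.1 h']; exact hyU)
      exact ⟨rr_out W _ _ d2 y hyz hy, rr_out W _ _ d3 y (fun h' => h' hyU) hy, hA y hyA⟩
    · left
      refine ⟨?_, rr_T W _ _ d3 y hyU⟩
      by_cases hyz : y ∈ ({z} : Set (Zd d))
      · rw [hh, hw, rr_T W _ _ d1 y hyz, rr_T W _ _ d2 y hyz]
      · rw [hh, hw, rr_out W _ _ d1 y hyz hyU, rr_out W _ _ d2 y hyz hy]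
  have u1 := max_princ hd (U \ A) hV
    (fun y => 1 * h y + (-1) * w y + (h 0 * (1 + δ)) * p y + (-(h 0 * (1 + δ))))
    (fun y hy => by
      obtain ⟨a, b, c⟩ := H y hy
      rw [nb_lin, a, b, c]; apply le_of_eq; ring)
    (fun y hy => by
      rcases B y hy with ⟨a, b⟩ | ⟨a, b, c⟩
      · rw [a, b]; apply le_of_eq; ring
      · rw [a, b]; rw [abs_le] at c; linarith) x
  have u2 := max_princ hd (U \ A) hV
    (fun y => (-1) * h y + 1 * w y + (-(h 0 * (1 - δ))) * p y + (h 0 * (1 - δ)))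
    (fun y hy => by
      obtain ⟨a, b, c⟩ := H y hy
      rw [nb_lin, a, b, c]; apply le_of_eq; ring)
    (fun y hy => by
      rcases B y hy with ⟨a, b⟩ | ⟨a, b, c⟩
      · rw [a, b]; apply le_of_eq; ring
      · rw [a, b]; rw [abs_le] at c; linarith) x
  have p0 : 0 ≤ p x := rr_nonneg W _ _ x
  have hδ : 0 ≤ δ * h 0 := (abs_nonneg _).trans hx
  rw [abs_le] at hx ⊢
  have := mul_nonneg hδ p0
  constructor <;> linarith

end
end Disconnection


/-- (A.7) and (A.9) in the proof of Lemma 1.3: for `x ∈ ∂B(0,2L)`,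
`P_x[T_U < H_A] ≥ P_x[H_{B(0,L)} = ∞] ≥ c' > 0`, and
`P_x[T_U < H_A, X_{T_U} = z] = h(0)·P_x[T_U < H_A]·(1 + γ(x))` with `|γ(x)| ≤ c''/K`,
where `h(w) = P_w[X_{T_U} = z]`. -/
theorem statement16 {d : ℕ} (hd : 3 ≤ d) {Ω : Type*} [MeasurableSpace Ω] (W : SRW d Ω) :
    ∃ c c' c'' : ℝ, 0 < c ∧ 0 < c' ∧ 0 < c'' ∧
      ∀ (L K : ℕ), 1 ≤ L → c ≤ (K : ℝ) →
        ∀ A : Set (Zd d), A ⊆ ball (0 : Zd d) L →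
          ∀ U : Set (Zd d), U.Finite → connSet U → ball (0 : Zd d) (K * L) ⊆ U →
            ∀ z ∈ bdry U, ∀ x ∈ bdry (ball (0 : Zd d) (2 * L)),
              (W.P x {ω | W.hit (ball (0 : Zd d) L) ω = ⊤}).toReal
                  ≤ (W.P x {ω | W.exit U ω < W.hit A ω}).toReal ∧
              c' ≤ (W.P x {ω | W.hit (ball (0 : Zd d) L) ω = ⊤}).toReal ∧
              ∃ γ : ℝ, |γ| ≤ c'' / K ∧
                (W.P x {ω | W.exit U ω < W.hit A ω ∧ W.Xat (W.exit U) ω = z}).toReal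
                  = (W.P 0 {ω | W.Xat (W.exit U) ω = z}).toReal *
                      (W.P x {ω | W.exit U ω < W.hit A ω}).toReal * (1 + γ) := by
  have hd0 : 0 < d := by omega
  have hdr : (0:ℝ) < d := by exact_mod_cast hd0
  have hC1 : 0 ≤ C1 d := Real.sqrt_nonneg _
  refine ⟨18 * (d:ℝ) + 6 * d * C1 d + 3, 1 / (80 * d), 2 * (12 * d * C1 d) * (80 * d) + 1,
    by positivity, by positivity, by positivity, ?_⟩
  intro L K hL hK A hA U hU _ hBU z hz x hx
  have hK1 : (1:ℝ) ≤ K := by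
    have : 0 ≤ 18 * (d:ℝ) + 6 * d * C1 d := by positivity
    linarith
  have hK1' : 1 ≤ K := by exact_mod_cast hK1
  have hprob := W.isProb x
  obtain ⟨hx3, j, σ, hσ, hxj⟩ := bdry_ball x (2 * L) hx
  have hLK : L ≤ K * L := Nat.le_mul_of_pos_left L hK1'
  have hball : ball (0 : Zd d) L ⊆ U := by
    intro y hy
    apply hBU
    rw [mem_ball0] at hy ⊢
    intro i
    exact (hy i).trans (by exact_mod_cast hLK)
  have hAU := hA.trans hball
  have e1 : W.P x {ω | W.hit (ball (0 : Zd d) L) ω = ⊤}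
      = W.P x (Reach W (ball (0 : Zd d) L)ᶜ (ball (0 : Zd d) L))ᶜ := by
    apply measure_congr
    filter_upwards [good_ae W x] with ω hg
    exact propext (hit_top_iff hg _)
  have e2 : W.P x {ω | W.exit U ω < W.hit A ω} = W.P x (Reach W (U \ A) Uᶜ) := by
    apply measure_congr
    filter_upwards [good_ae W x] with ω hg
    exact propext (exit_lt_iff hg _ _ hAU)
  have e3 : W.P x {ω | W.exit U ω < W.hit A ω ∧ W.Xat (W.exit U) ω = z}
      = W.P x (Reach W (U \ A) {z}) := by
    apply measure_congr
    filter_upwards [good_ae W x] with ω hg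
    exact propext (exit_xat_iff hg _ _ hAU z hz.1)
  have e4 : W.P 0 {ω | W.Xat (W.exit U) ω = z} = W.P 0 (Reach W U {z}) := by
    apply measure_congr
    filter_upwards [good_ae W 0, exit_ae W hd0 U hU 0] with ω hg hr
    exact propext (xat_iff hg _ z hz.1 hr)
  have i1 : (W.P x {ω | W.hit (ball (0 : Zd d) L) ω = ⊤}).toReal
      ≤ (W.P x {ω | W.exit U ω < W.hit A ω}).toReal := by
    apply ENNReal.toReal_mono (measure_ne_top _ _)
    rw [e1, e2]
    apply measure_mono_ae
    filter_upwards [exit_ae W hd0 U hU x] with ω hr hn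
    obtain ⟨m, hm, hk⟩ := hr
    refine ⟨m, hm, fun k hkm => ⟨hk k hkm, fun hkA => hn ?_⟩⟩
    have hex : ∃ n, W.Y n ω ∈ ball (0 : Zd d) L := ⟨k, hA hkA⟩
    exact ⟨Nat.find hex, Nat.find_spec hex, fun k hk => Nat.find_min hex hk⟩
  have i2 : 1 / (80 * (d:ℝ)) ≤ (W.P x {ω | W.hit (ball (0 : Zd d) L) ω = ⊤}).toReal := by
    obtain ⟨G, g0, g1, g2, g3⟩ := barrier hd L hL j σ hσ
    have h1 := rr_min W hd0 (ball (0 : Zd d) L)ᶜ (ball (0 : Zd d) L) disjoint_compl_left G g0 g1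
      (fun y hy => g2 y ((mem_ball0 y L).1 hy)) x
    have h2 := g3 x (by push_cast at hxj; exact hxj)
    rw [e1, prob_compl_eq_one_sub (meas_reach W _ _), ENNReal.toReal_sub_of_le prob_le_one one_ne_top,
      ENNReal.toReal_one]
    change 1 / (80 * (d:ℝ)) ≤ 1 - rr W (ball (0 : Zd d) L)ᶜ (ball (0 : Zd d) L) x
    linarith
  refine ⟨i1, i2, ?_⟩
  have i3 := i2.trans i1
  rw [e2] at i3
  rw [e2, e3, e4]
  change 1 / (80 * (d:ℝ)) ≤ rr W (U \ A) Uᶜ x at i3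
  change ∃ γ : ℝ, _ ∧ rr W (U \ A) {z} x = rr W U {z} 0 * rr W (U \ A) Uᶜ x * (1 + γ)
  have hgrad := grad_nonneg hd0 (u := rr W U {z}) (rr_nonneg W _ _) L K hL (by linarith)
    (fun y hy => rr_harm W hd0 _ _ (by simpa using hz.1) y (hBU ((mem_ball0 y _).2 hy)))
  have hest := main_est W hd0 A U hU hAU z hz.1 (12 * d * C1 d / K)
    (fun y hy => hgrad y fun i => by
      have := (mem_ball0 y L).1 (hA hy) i
      omega) x
    (hgrad x fun i => by
      have := hx3 i
      push_cast at this
      omega)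
  set w := rr W (U \ A) {z} x
  set p := rr W (U \ A) Uᶜ x
  have h00 : 0 ≤ rr W U {z} 0 := rr_nonneg W _ _ 0
  set h0 := rr W U {z} 0
  have hp : 0 < p := lt_of_lt_of_le (by positivity) i3
  have hKp : (0:ℝ) < K := by linarith
  rcases h00.eq_or_lt with h | h
  · refine ⟨0, by simp; positivity, ?_⟩
    rw [← h] at hest ⊢
    simpa using hest
  · refine ⟨w / (h0 * p) - 1, ?_, ?_⟩
    · have : w / (h0 * p) - 1 = (w - h0 * p) / (h0 * p) := by field_simp
      rw [this, abs_div, abs_of_pos (mul_pos h hp), div_le_iff₀ (mul_pos h hp)]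
      refine hest.trans ?_
      have hp' : 1 ≤ 80 * d * p := by
        rw [div_le_iff₀ (by positivity)] at i3
        linarith
      calc 2 * (12 * d * C1 d / K) * h0 = (2 * (12 * d * C1 d) / K * h0) * 1 := by ring
        _ ≤ (2 * (12 * d * C1 d) / K * h0) * (80 * d * p) :=
            mul_le_mul_of_nonneg_left hp' (by positivity)
        _ = (2 * (12 * d * C1 d) * (80 * d)) / K * (h0 * p) := by ring
        _ ≤ _ := by
            gcongr
            linarith
    · field_simp
      ring
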